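/- arXiv:2309.06970 — 6 statements merged into one kernel-verified Lean document; each statement's English description precedes it below -/
import Mathlib

section
/- Main Poincaré inequality via the new path method (Theorem 2.5). Suppose there exist: (1) a map t : S → S and, for each x ∈ S, an active directed path γ_x from x to t(x), such that (a) sup_{x∈S} |γ_x| < ∞, (b) sup over ordered pairs (z,w) ∈ S×S of the number of states x ∈ S such that (z,w) is an edge of γ_x is finite, and (c) sup_{x∈S} π(x)/π_min(γ_x) < ∞; (2) a family Γ_T of active directed paths containing, for each pair of distinct terminal states t(x) ≠ t(x'), exactly one active directed path between them (either from t(x) to t(x') or from t(x') to t(x), but not both), such that the sum over ordered pairs (x,x') ∈ S×S with x ≠ x' of |γ(t(x),t(x'))| · π(x)π(x')/π_min(γ(t(x),t(x'))) is finite, where a term is taken to be 0 whenever the path γ(t(x),t(x')) with that orientation does not belong to Γ_T; (3) a constant c_min > 0 such that q(z,z') ≥ c_min for every edge (z,z') of every path γ_x and of every path in Γ_T. Then there exists a constant C > 0 such that for every bounded function f : S → ℝ one has E*(f) ≥ C · Var_π(f). -/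
open scoped ENNReal

/-- Dirichlet form `E*(f) = (1/2) Σ_{x,z} (f(x)-f(z))² π(x) q(x,z)`, with values in `[0,∞]`. -/
noncomputable def Estar {α : Type*} (π : α → ℝ) (q : α → α → ℝ) (f : α → ℝ) : ℝ≥0∞ :=
  (∑' p : α × α, ENNReal.ofReal ((f p.1 - f p.2) ^ 2 * π p.1 * q p.1 p.2)) / 2

/-- Variance of `f` with respect to `π`. -/
noncomputable def varPi {α : Type*} (π : α → ℝ) (f : α → ℝ) : ℝ :=
  (∑' x, f x ^ 2 * π x) - (∑' x, f x * π x) ^ 2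

/-- Edges of a directed path given as a list of states. -/
def edges {α : Type*} (p : List α) : List (α × α) := p.zip p.tail

/-- `p` is a directed path from `a` to `b`: a nonempty list of distinct states
starting at `a` and ending at `b`. -/
def IsPathFromTo {α : Type*} (p : List α) (a b : α) : Prop :=
  p.Nodup ∧ p.head? = some a ∧ p.getLast? = some b

/-- A path is active if all its edges have positive rate. -/
def ActivePath {α : Type*} (q : α → α → ℝ) (p : List α) : Prop :=
  ∀ e ∈ edges p, 0 < q e.1 e.2

/-- `π_min(γ)`: the minimal weight among the states of the path `γ`. -/
noncomputable def piMin {α : Type*} (π : α → ℝ) (p : List α) : ℝ :=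
  sInf (π '' {z | z ∈ p})

section helpers

theorem edges_cons_cons {α : Type*} (a b : α) (l : List α) :
    edges (a :: b :: l) = (a, b) :: edges (b :: l) := by
  simp [edges]

theorem edges_fst_mem {α : Type*} (p : List α) (e : α × α) (h : e ∈ edges p) : e.1 ∈ p := by
  obtain ⟨x, y⟩ := e
  exact (List.of_mem_zip h).1

theorem edges_nodup {α : Type*} (p : List α) (h : p.Nodup) : (edges p).Nodup := by
  induction p with
  | nil => simp [edges]
  | cons a l ih =>
    cases l with
    | nil => simp [edges]
    | cons b l =>
      rw [edges_cons_cons, List.nodup_cons]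
      refine ⟨fun hm => ?_, ih (List.nodup_cons.1 h).2⟩
      exact (List.nodup_cons.1 h).1 (edges_fst_mem _ _ hm)

theorem edges_length_le {α : Type*} (p : List α) : (edges p).length ≤ p.length := by
  simp [edges]

theorem edges_telescope {α : Type*} (f : α → ℝ) (p : List α) (a b : α)
    (h1 : p.head? = some a) (h2 : p.getLast? = some b) :
    f a - f b = ((edges p).map (fun e => f e.1 - f e.2)).sum := by
  induction p generalizing a with
  | nil => simp at h1
  | cons c l ih =>
    simp only [List.head?_cons, Option.some.injEq] at h1
    subst h1
    cases l with
    | nil =>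
      simp at h2
      subst h2
      simp [edges]
    | cons d l =>
      rw [edges_cons_cons, List.map_cons, List.sum_cons,
        ← ih d (by simp) (by simpa [List.getLast?_cons_cons] using h2)]
      ring

theorem piMin_le {α : Type*} (π : α → ℝ) (p : List α) (z : α) (h : z ∈ p) :
    piMin π p ≤ π z :=
  csInf_le ((p.finite_toSet.image π).bddBelow) ⟨z, h, rfl⟩

theorem piMin_pos {α : Type*} (π : α → ℝ) (hπ : ∀ x, 0 < π x) (p : List α) (z : α) (h : z ∈ p) :
    0 < piMin π p := by
  have : piMin π p ∈ π '' {z | z ∈ p} :=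
    Set.Nonempty.csInf_mem ⟨_, z, h, rfl⟩ (p.finite_toSet.image π)
  obtain ⟨y, _, hy⟩ := this
  rw [← hy]
  exact hπ y

theorem path_bound {α : Type*} [DecidableEq (α × α)] (π : α → ℝ) (hπ : ∀ x, 0 < π x) (q : α → α → ℝ)
    (f : α → ℝ) (p : List α) (a b : α) (hp : IsPathFromTo p a b)
    (c : ℝ) (hc : 0 < c) (hqe : ∀ e ∈ edges p, c ≤ q e.1 e.2) (w : ℝ) (hw : 0 ≤ w) :
    ENNReal.ofReal ((f a - f b) ^ 2 * w) ≤
      ENNReal.ofReal (1 / c) * ENNReal.ofReal ((p.length : ℝ) * (w / piMin π p)) *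
      ∑ e ∈ (edges p).toFinset, ENNReal.ofReal ((f e.1 - f e.2) ^ 2 * π e.1 * q e.1 e.2) := by
  obtain ⟨hn, h1, h2⟩ := hp
  have ha : a ∈ p := List.mem_of_mem_head? (by simp [h1])
  have hm := piMin_pos π hπ p a ha
  have hnn : ∀ e ∈ (edges p).toFinset, 0 ≤ (f e.1 - f e.2) ^ 2 * π e.1 * q e.1 e.2 := by
    intro e he
    have := hqe e (List.mem_toFinset.1 he)
    have := hπ e.1
    have : 0 ≤ q e.1 e.2 := by linarith
    positivity
  rw [← ENNReal.ofReal_sum_of_nonneg hnn, ← ENNReal.ofReal_mul (by positivity),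
    ← ENNReal.ofReal_mul (by positivity)]
  apply ENNReal.ofReal_le_ofReal
  have htel := edges_telescope f p a b h1 h2
  rw [← List.sum_toFinset _ (edges_nodup p hn)] at htel
  have hcs := sq_sum_le_card_mul_sum_sq (s := (edges p).toFinset) (f := fun e => f e.1 - f e.2)
  rw [← htel] at hcs
  have hcard : (((edges p).toFinset.card : ℕ) : ℝ) ≤ p.length := by
    exact_mod_cast (List.toFinset_card_le _).trans (edges_length_le p)
  have hs : (c * piMin π p) * ∑ e ∈ (edges p).toFinset, (f e.1 - f e.2) ^ 2 ≤
      ∑ e ∈ (edges p).toFinset, (f e.1 - f e.2) ^ 2 * π e.1 * q e.1 e.2 := by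
    rw [Finset.mul_sum]
    apply Finset.sum_le_sum
    intro e he
    have he' := List.mem_toFinset.1 he
    have h3 := hqe e he'
    have h4 := piMin_le π p e.1 (edges_fst_mem _ _ he')
    have h5 : c * piMin π p ≤ q e.1 e.2 * π e.1 := mul_le_mul h3 h4 hm.le (by linarith)
    calc _ ≤ (q e.1 e.2 * π e.1) * (f e.1 - f e.2) ^ 2 :=
          mul_le_mul_of_nonneg_right h5 (sq_nonneg _)
      _ = _ := by ring
  have hS0 : 0 ≤ ∑ e ∈ (edges p).toFinset, (f e.1 - f e.2) ^ 2 :=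
    Finset.sum_nonneg fun _ _ => sq_nonneg _
  calc (f a - f b) ^ 2 * w
      ≤ (p.length * ∑ e ∈ (edges p).toFinset, (f e.1 - f e.2) ^ 2) * w :=
        mul_le_mul_of_nonneg_right
          (hcs.trans (mul_le_mul_of_nonneg_right hcard hS0)) hw
    _ = 1 / c * (p.length * (w / piMin π p)) *
        ((c * piMin π p) * ∑ e ∈ (edges p).toFinset, (f e.1 - f e.2) ^ 2) := by
        field_simp
    _ ≤ _ := mul_le_mul_of_nonneg_left hs (by positivity)

theorem prod_hasSum {α : Type*} (u v : α → ℝ) (a b : ℝ) (hu : HasSum u a) (hv : HasSum v b) :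
    HasSum (fun p : α × α => u p.1 * v p.2) (a * b) :=
  HasSum.mul hu hv (summable_mul_of_summable_norm hu.summable.norm hv.summable.norm)

theorem var_double {α : Type*} (π : α → ℝ) (hπ : ∀ x, 0 < π x) (h1 : HasSum π 1)
    (f : α → ℝ) (hf : ∃ K, ∀ x, |f x| ≤ K) :
    ENNReal.ofReal (2 * varPi π f) =
      ∑' p : α × α, ENNReal.ofReal ((f p.1 - f p.2) ^ 2 * (π p.1 * π p.2)) := by
  obtain ⟨K, hK⟩ := hf
  have hb : Summable (fun x => f x * π x) := by
    refine Summable.of_norm_bounded (h1.summable.mul_left K) fun x => ?_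
    rw [norm_mul, Real.norm_eq_abs, Real.norm_eq_abs, abs_of_pos (hπ x)]
    exact mul_le_mul_of_nonneg_right (hK x) (hπ x).le
  have ha : Summable (fun x => f x ^ 2 * π x) := by
    refine Summable.of_norm_bounded (h1.summable.mul_left (K ^ 2)) fun x => ?_
    rw [norm_mul, Real.norm_eq_abs, Real.norm_eq_abs, abs_of_pos (hπ x), abs_pow]
    exact mul_le_mul_of_nonneg_right (pow_le_pow_left₀ (abs_nonneg _) (hK x) 2) (hπ x).le
  have e1 := prod_hasSum _ _ _ _ ha.hasSum h1
  have e2 := prod_hasSum _ _ _ _ h1 ha.hasSum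
  have e3 := prod_hasSum _ _ _ _ hb.hasSum hb.hasSum
  have e4 := (e1.add e2).sub (e3.mul_left 2)
  have e5 : HasSum (fun p : α × α => (f p.1 - f p.2) ^ 2 * (π p.1 * π p.2))
      (2 * varPi π f) := by
    have hval : (∑' x, f x ^ 2 * π x) * 1 + 1 * (∑' x, f x ^ 2 * π x)
        - 2 * ((∑' x, f x * π x) * (∑' x, f x * π x)) = 2 * varPi π f := by
      unfold varPi; ring
    rw [← hval]
    have hfun : (fun p : α × α => (f p.1 - f p.2) ^ 2 * (π p.1 * π p.2)) =
        fun p : α × α => f p.1 ^ 2 * π p.1 * π p.2 + π p.1 * (f p.2 ^ 2 * π p.2)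
          - 2 * (f p.1 * π p.1 * (f p.2 * π p.2)) := by
      funext p; ring
    rw [hfun]
    exact e4
  have hnn : ∀ p : α × α, 0 ≤ (f p.1 - f p.2) ^ 2 * (π p.1 * π p.2) := fun p =>
    mul_nonneg (sq_nonneg _) (mul_pos (hπ p.1) (hπ p.2)).le
  rw [← ENNReal.ofReal_tsum_of_nonneg hnn e5.summable, e5.tsum_eq]

end helpers

/-- Theorem 2.5: the new path method Poincaré inequality. -/
theorem main_poincare {d : ℕ} (S : Set (Fin d → ℤ))
    (q : S → S → ℝ) (π : S → ℝ)
    (hq : ∀ x z : S, x ≠ z → 0 ≤ q x z)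
    (hπpos : ∀ x, 0 < π x) (hπ1 : HasSum π 1)
    -- Condition 1: finite steps to a terminal state
    (t : S → S) (γ : S → List S)
    (hpath : ∀ x, IsPathFromTo (γ x) x (t x))
    (hactive : ∀ x, ActivePath q (γ x))
    (L : ℕ) (hL : ∀ x, (γ x).length ≤ L)
    (M : ℕ)
    (hM : ∀ z w : S, {x : S | (z, w) ∈ edges (γ x)}.Finite ∧
      {x : S | (z, w) ∈ edges (γ x)}.ncard ≤ M)
    (B : ℝ) (hB : ∀ x, π x / piMin π (γ x) ≤ B)
    -- Condition 2: a family of paths between terminal states with fast decay of π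
    (chosen : S → S → Bool) (g : S → S → List S)
    (hchosen : ∀ x x' : S, t x ≠ t x' →
      Xor' (chosen (t x) (t x') = true) (chosen (t x') (t x) = true))
    (hgpath : ∀ x x' : S, t x ≠ t x' → chosen (t x) (t x') = true →
      IsPathFromTo (g (t x) (t x')) (t x) (t x') ∧ ActivePath q (g (t x) (t x')))
    (hsum : (∑' p : ↥S × ↥S,
        if p.1 ≠ p.2 ∧ t p.1 ≠ t p.2 ∧ chosen (t p.1) (t p.2) = true then
          ENNReal.ofReal (((g (t p.1) (t p.2)).length : ℝ) *
            (π p.1 * π p.2 / piMin π (g (t p.1) (t p.2))))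
        else 0) < ⊤)
    -- Condition 3: uniform lower bound for transition rates along the paths
    (cmin : ℝ) (hcmin : 0 < cmin)
    (hqγ : ∀ x, ∀ e ∈ edges (γ x), cmin ≤ q e.1 e.2)
    (hqΓ : ∀ x x' : S, t x ≠ t x' → chosen (t x) (t x') = true →
      ∀ e ∈ edges (g (t x) (t x')), cmin ≤ q e.1 e.2) :
    ∃ C > 0, ∀ f : S → ℝ, (∃ Kb, ∀ x, |f x| ≤ Kb) →
      ENNReal.ofReal (C * varPi π f) ≤ Estar π q f := by
  classical
  set W := (∑' p : ↥S × ↥S,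
        if p.1 ≠ p.2 ∧ t p.1 ≠ t p.2 ∧ chosen (t p.1) (t p.2) = true then
          ENNReal.ofReal (((g (t p.1) (t p.2)).length : ℝ) *
            (π p.1 * π p.2 / piMin π (g (t p.1) (t p.2))))
        else 0) with hW
  set c1 : ℝ≥0∞ := ENNReal.ofReal (1 / cmin) with hc1
  -- the constant
  set K1 : ℝ≥0∞ := c1 * ENNReal.ofReal (L * B) * M with hK1
  set K : ℝ≥0∞ := 3 * (K1 + 2 * (c1 * W) + K1) with hK
  have hKtop : K ≠ ⊤ := by
    have : W ≠ ⊤ := hsum.ne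
    have h1 : K1 ≠ ⊤ := by
      rw [hK1]
      exact ENNReal.mul_ne_top (ENNReal.mul_ne_top ENNReal.ofReal_ne_top ENNReal.ofReal_ne_top)
        (ENNReal.natCast_ne_top M)
    rw [hK]
    refine ENNReal.mul_ne_top (by simp) (ENNReal.add_ne_top.2 ⟨ENNReal.add_ne_top.2 ⟨h1, ?_⟩, h1⟩)
    exact ENNReal.mul_ne_top (by simp) (ENNReal.mul_ne_top ENNReal.ofReal_ne_top this)
  refine ⟨1 / (K.toReal + 1), by positivity, fun f hf => ?_⟩
  set D : S × S → ℝ≥0∞ := fun e => ENNReal.ofReal ((f e.1 - f e.2) ^ 2 * π e.1 * q e.1 e.2) with hD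
  set T : ℝ≥0∞ := ∑' e, D e with hT
  -- part A
  have hA : ∑' x, ENNReal.ofReal ((f x - f (t x)) ^ 2 * π x) ≤ K1 * T := by
    have step : ∀ x, ENNReal.ofReal ((f x - f (t x)) ^ 2 * π x) ≤
        c1 * ENNReal.ofReal (L * B) * ∑' e, (if e ∈ edges (γ x) then D e else 0) := by
      intro x
      refine (path_bound π hπpos q f (γ x) x (t x) (hpath x) cmin hcmin (hqγ x) (π x)
        (hπpos x).le).trans ?_
      have hx : x ∈ γ x := List.mem_of_mem_head? (by simp [(hpath x).2.1])
      have hm := piMin_pos π hπpos (γ x) x hx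
      have h0 : 0 ≤ π x / piMin π (γ x) := div_nonneg (hπpos x).le hm.le
      gcongr
      · exact_mod_cast hL x
      · exact hB x
      · rw [tsum_eq_sum (s := (edges (γ x)).toFinset)]
        · apply Finset.sum_le_sum
          intro e he
          rw [if_pos (List.mem_toFinset.1 he)]
        · intro e he
          rw [if_neg (fun h => he (List.mem_toFinset.2 h))]
    calc _ ≤ ∑' x, c1 * ENNReal.ofReal (L * B) * ∑' e, (if e ∈ edges (γ x) then D e else 0) :=
          ENNReal.tsum_le_tsum step
      _ = c1 * ENNReal.ofReal (L * B) * ∑' e, ∑' x, (if e ∈ edges (γ x) then D e else 0) := by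
          rw [ENNReal.tsum_mul_left, ENNReal.tsum_comm]
      _ ≤ c1 * ENNReal.ofReal (L * B) * ∑' e, M * D e := by
          gcongr with e
          obtain ⟨hfin, hcard⟩ := hM e.1 e.2
          rw [tsum_eq_sum (s := hfin.toFinset)]
          · calc _ ≤ ∑ x ∈ hfin.toFinset, D e := by
                  apply Finset.sum_le_sum
                  intro x _
                  split_ifs <;> simp
              _ = (hfin.toFinset.card : ℝ≥0∞) * D e := by simp
              _ ≤ _ := by
                  gcongr
                  rw [← Set.ncard_eq_toFinset_card _ hfin]
                  exact hcard
          · intro x hx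
            rw [if_neg]
            intro h
            exact hx (by simpa using h)
      _ = K1 * T := by
          rw [ENNReal.tsum_mul_left, hK1]; ring
  -- part B
  set w : S × S → ℝ≥0∞ := fun p =>
        if p.1 ≠ p.2 ∧ t p.1 ≠ t p.2 ∧ chosen (t p.1) (t p.2) = true then
          ENNReal.ofReal (((g (t p.1) (t p.2)).length : ℝ) *
            (π p.1 * π p.2 / piMin π (g (t p.1) (t p.2))))
        else 0 with hw
  have hch : ∀ x y : S, t x ≠ t y → chosen (t x) (t y) = true →
      ENNReal.ofReal ((f (t x) - f (t y)) ^ 2 * (π x * π y)) ≤ c1 * w (x, y) * T := by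
    intro x y hne hc
    refine (path_bound π hπpos q f _ _ _ (hgpath x y hne hc).1 cmin hcmin (hqΓ x y hne hc)
      (π x * π y) (mul_pos (hπpos x) (hπpos y)).le).trans ?_
    have : w (x, y) = ENNReal.ofReal (((g (t x) (t y)).length : ℝ) *
            (π x * π y / piMin π (g (t x) (t y)))) := by
      rw [hw]
      exact if_pos ⟨fun h => hne (congrArg t h), hne, hc⟩
    rw [this]
    gcongr
    exact ENNReal.sum_le_tsum _
  have hBB : ∑' p : S × S, ENNReal.ofReal ((f (t p.1) - f (t p.2)) ^ 2 * (π p.1 * π p.2)) ≤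
      2 * (c1 * W) * T := by
    have step : ∀ p : S × S, ENNReal.ofReal ((f (t p.1) - f (t p.2)) ^ 2 * (π p.1 * π p.2)) ≤
        c1 * w p * T + c1 * w p.swap * T := by
      rintro ⟨x, y⟩
      by_cases hne : t x = t y
      · simp [hne]
      · rcases hchosen x y hne with h | h
        · exact (hch x y hne h.1).trans le_self_add
        · have h3 := hch y x (Ne.symm hne) h.1
          refine le_trans (le_of_eq ?_) (h3.trans le_add_self)
          congr 1
          ring
    calc _ ≤ ∑' p : S × S, (c1 * w p * T + c1 * w p.swap * T) := ENNReal.tsum_le_tsum step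
      _ = 2 * (c1 * W) * T := by
        rw [ENNReal.tsum_add, ENNReal.tsum_mul_right, ENNReal.tsum_mul_right,
          ENNReal.tsum_mul_left, ENNReal.tsum_mul_left,
          show ∑' p : S × S, w p.swap = ∑' p, w p from (Equiv.prodComm S S).tsum_eq w]
        rw [hW]
        ring
  -- total mass
  have hmass : ∑' x, ENNReal.ofReal (π x) = 1 := by
    rw [← ENNReal.ofReal_tsum_of_nonneg (fun x => (hπpos x).le) hπ1.summable, hπ1.tsum_eq]
    simp
  have hvar : ENNReal.ofReal (2 * varPi π f) ≤ K * T := by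
    rw [var_double π hπpos hπ1 f hf]
    have step : ∀ p : S × S, ENNReal.ofReal ((f p.1 - f p.2) ^ 2 * (π p.1 * π p.2)) ≤
        3 * (ENNReal.ofReal ((f p.1 - f (t p.1)) ^ 2 * π p.1) * ENNReal.ofReal (π p.2)
          + ENNReal.ofReal ((f (t p.1) - f (t p.2)) ^ 2 * (π p.1 * π p.2))
          + ENNReal.ofReal (π p.1) * ENNReal.ofReal ((f p.2 - f (t p.2)) ^ 2 * π p.2)) := by
      rintro ⟨x, y⟩
      have hx := hπpos x
      have hy := hπpos y
      rw [show (3 : ℝ≥0∞) = ENNReal.ofReal 3 by simp,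
        ← ENNReal.ofReal_mul (by positivity), ← ENNReal.ofReal_mul (by positivity),
        ← ENNReal.ofReal_add (by positivity) (by positivity),
        ← ENNReal.ofReal_add (by positivity) (by positivity),
        ← ENNReal.ofReal_mul (by positivity)]
      apply ENNReal.ofReal_le_ofReal
      have key : (f x - f y) ^ 2 ≤ 3 * ((f x - f (t x)) ^ 2 + (f (t x) - f (t y)) ^ 2
          + (f y - f (t y)) ^ 2) := by
        nlinarith [sq_nonneg ((f x - f (t x)) - (f (t x) - f (t y))),
          sq_nonneg ((f x - f (t x)) + (f y - f (t y))),
          sq_nonneg ((f (t x) - f (t y)) + (f y - f (t y)))]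
      have := mul_le_mul_of_nonneg_right key (mul_pos hx hy).le
      simp only
      linarith
    calc _ ≤ _ := ENNReal.tsum_le_tsum step
      _ = 3 * ((∑' x, ENNReal.ofReal ((f x - f (t x)) ^ 2 * π x))
          + ∑' p : S × S, ENNReal.ofReal ((f (t p.1) - f (t p.2)) ^ 2 * (π p.1 * π p.2))
          + ∑' x, ENNReal.ofReal ((f x - f (t x)) ^ 2 * π x)) := by
        have m1 : ∑' p : S × S, ENNReal.ofReal ((f p.1 - f (t p.1)) ^ 2 * π p.1) *
            ENNReal.ofReal (π p.2) = ∑' x, ENNReal.ofReal ((f x - f (t x)) ^ 2 * π x) := by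
          rw [ENNReal.tsum_prod']
          simp only [ENNReal.tsum_mul_left, hmass, mul_one]
        have m2 : ∑' p : S × S, ENNReal.ofReal (π p.1) *
            ENNReal.ofReal ((f p.2 - f (t p.2)) ^ 2 * π p.2) =
            ∑' x, ENNReal.ofReal ((f x - f (t x)) ^ 2 * π x) := by
          rw [ENNReal.tsum_prod']
          simp only [ENNReal.tsum_mul_left, ENNReal.tsum_mul_right, hmass, one_mul]
        rw [ENNReal.tsum_mul_left, ENNReal.tsum_add, ENNReal.tsum_add, m1, m2]
      _ ≤ 3 * (K1 * T + 2 * (c1 * W) * T + K1 * T) := by gcongr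
      _ = K * T := by rw [hK]; ring
  -- conclusion
  have hE : Estar π q f = T / 2 := rfl
  rw [hE, ENNReal.le_div_iff_mul_le (by simp) (by simp)]
  have h2 : ENNReal.ofReal (1 / (K.toReal + 1) * varPi π f) * 2 =
      ENNReal.ofReal (1 / (K.toReal + 1)) * ENNReal.ofReal (2 * varPi π f) := by
    rw [ENNReal.ofReal_mul (p := 1 / (K.toReal + 1)) (by positivity),
      ENNReal.ofReal_mul (p := 2) (by positivity), ENNReal.ofReal_ofNat]
    ring
  rw [h2]
  calc _ ≤ ENNReal.ofReal (1 / (K.toReal + 1)) * (K * T) := by gcongr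
    _ = ENNReal.ofReal (1 / (K.toReal + 1) * K.toReal) * T := by
      rw [ENNReal.ofReal_mul (by positivity), ENNReal.ofReal_toReal hKtop, ← mul_assoc]
    _ ≤ 1 * T := by
      gcongr
      rw [← ENNReal.ofReal_one]
      apply ENNReal.ofReal_le_ofReal
      rw [one_div, inv_mul_le_iff₀ (by positivity)]
      linarith
    _ = T := one_mul T
end

section
/- Corollary 2.6. Let S = ℤ^d_{≥0} and suppose: (1) there exist an integer K > 0 and α > 0 such that for each i ∈ {1,…,d} and every x ∈ ℤ^d_{≥0} with x_i ≥ K one has π(x)/π(x−e_i) ≤ 1/x_i^α; and (2) there exists c_min > 0 such that for each i ∈ {1,…,d}, q(x,x+e_i) ≥ c_min for all x ∈ ℤ^d_{≥0}, and q(x,x−e_i) ≥ c_min for all x ∈ ℤ^d_{≥0} with x_i ≥ 1. Then there exists a constant C > 0 such that for every bounded function f : ℤ^d_{≥0} → ℝ one has E*(f) ≥ C · Var_π(f). -/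
open scoped ENNReal

/-- The canonical basis vector `e_i` of `ℤ^d_{≥0}`. -/
def eN {d : ℕ} (i : Fin d) : Fin d → ℕ := fun j => if j = i then 1 else 0

open scoped NNReal

noncomputable def Asum {α : Type*} (π : α → ℝ) (q : α → α → ℝ) (f : α → ℝ) : ℝ≥0∞ :=
  ∑' p : α × α, ENNReal.ofReal ((f p.1 - f p.2) ^ 2 * π p.1 * q p.1 p.2)

lemma sub_add_eN {d : ℕ} (i : Fin d) (x : Fin d → ℕ) (h : 1 ≤ x i) : x - eN i + eN i = x := by
  funext j
  simp only [Pi.add_apply, Pi.sub_apply, eN]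
  split_ifs with hj
  · subst hj; omega
  · simp

lemma add_sub_eN {d : ℕ} (i : Fin d) (x : Fin d → ℕ) : x + eN i - eN i = x := by
  funext j
  simp [Pi.add_apply, Pi.sub_apply]

lemma tsum_shift {d : ℕ} (i : Fin d) (h : (Fin d → ℕ) → ℝ≥0∞) (hh : ∀ x, x i = 0 → h x = 0) :
    ∑' x, h x = ∑' y, h (y + eN i) := by
  symm
  apply Function.Injective.tsum_eq (g := fun y : Fin d → ℕ => y + eN i)
  · intro a b hab
    simpa using hab
  · intro x hx
    have : x i ≠ 0 := fun h0 => hx (hh x h0)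
    exact ⟨x - eN i, sub_add_eN i x (by omega)⟩

lemma edge_le {d : ℕ} (q : (Fin d → ℕ) → (Fin d → ℕ) → ℝ) (π : (Fin d → ℕ) → ℝ)
    (hπpos : ∀ x, 0 < π x) (cmin : ℝ) (hcmin : 0 < cmin)
    (hdeath : ∀ (i : Fin d) (x : Fin d → ℕ), 1 ≤ x i → cmin ≤ q x (x - eN i))
    (f : (Fin d → ℕ) → ℝ) (i : Fin d) (x : Fin d → ℕ) (hx : 1 ≤ x i) :
    ENNReal.ofReal ((f x - f (x - eN i)) ^ 2 * π x) ≤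
      ENNReal.ofReal (1 / cmin) *
        ENNReal.ofReal ((f x - f (x - eN i)) ^ 2 * π x * q x (x - eN i)) := by
  rw [← ENNReal.ofReal_mul (by positivity)]
  apply ENNReal.ofReal_le_ofReal
  have h1 := hdeath i x hx
  have h2 : 0 ≤ (f x - f (x - eN i)) ^ 2 * π x := mul_nonneg (sq_nonneg _) (hπpos x).le
  rw [one_div, ← div_eq_inv_mul, le_div_iff₀ hcmin]
  exact mul_le_mul_of_nonneg_left h1 h2

lemma edge_sum_le {d : ℕ} (q : (Fin d → ℕ) → (Fin d → ℕ) → ℝ) (π : (Fin d → ℕ) → ℝ)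
    (hπpos : ∀ x, 0 < π x) (cmin : ℝ) (hcmin : 0 < cmin)
    (hdeath : ∀ (i : Fin d) (x : Fin d → ℕ), 1 ≤ x i → cmin ≤ q x (x - eN i))
    (f : (Fin d → ℕ) → ℝ) (i : Fin d) :
    ∑' x, (if 1 ≤ x i then ENNReal.ofReal ((f x - f (x - eN i)) ^ 2 * π x) else 0) ≤
      ENNReal.ofReal (1 / cmin) * Asum π q f := by
  calc _ ≤ ∑' x : Fin d → ℕ, ENNReal.ofReal (1 / cmin) *
        ENNReal.ofReal ((f x - f (x - eN i)) ^ 2 * π x * q x (x - eN i)) := by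
        apply ENNReal.tsum_le_tsum
        intro x
        split_ifs with hx
        · exact edge_le q π hπpos cmin hcmin hdeath f i x hx
        · exact zero_le
    _ ≤ _ := by
        rw [ENNReal.tsum_mul_left]
        gcongr
        have hinj : Function.Injective (fun x : Fin d → ℕ => (x, x - eN i)) := by
          intro a b hab
          exact (Prod.ext_iff.1 hab).1
        exact ENNReal.tsum_comp_le_tsum_of_injective hinj
          (fun p => ENNReal.ofReal ((f p.1 - f p.2) ^ 2 * π p.1 * q p.1 p.2))

lemma point_le {d : ℕ} (q : (Fin d → ℕ) → (Fin d → ℕ) → ℝ) (π : (Fin d → ℕ) → ℝ)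
    (hπpos : ∀ x, 0 < π x) (cmin : ℝ) (hcmin : 0 < cmin)
    (hdeath : ∀ (i : Fin d) (x : Fin d → ℕ), 1 ≤ x i → cmin ≤ q x (x - eN i)) (n : ℕ) :
    ∀ x : Fin d → ℕ, ∑ i, x i = n → ∃ C : ℝ≥0, ∀ f : (Fin d → ℕ) → ℝ,
      ENNReal.ofReal ((f x - f 0) ^ 2) ≤ C * Asum π q f := by
  induction n with
  | zero =>
    intro x hx
    have : x = 0 := by
      funext i
      simpa using (Finset.sum_eq_zero_iff.1 hx) i (Finset.mem_univ i)
    subst this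
    exact ⟨0, fun f => by simp⟩
  | succ n ih =>
    intro x hx
    have : ∃ i, 1 ≤ x i := by
      by_contra! hcon
      have : ∑ i, x i = 0 := Finset.sum_eq_zero (fun i _ => by have := hcon i; omega)
      omega
    obtain ⟨i, hi⟩ := this
    have hs : ∑ j, (x - eN i) j = n := by
      have h1 : ∑ j, (x - eN i + eN i) j = n + 1 := by rw [sub_add_eN i x hi]; exact hx
      simp only [Pi.add_apply] at h1
      rw [Finset.sum_add_distrib] at h1
      have h2 : ∑ j, eN i j = 1 := by simp [eN]
      omega
    obtain ⟨C, hC⟩ := ih _ hs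
    refine ⟨2 * (Real.toNNReal (1 / π x) * Real.toNNReal (1 / cmin)) + 2 * C, fun f => ?_⟩
    have hpx := hπpos x
    have h1 : ENNReal.ofReal ((f x - f 0) ^ 2) ≤
        2 * ENNReal.ofReal ((f x - f (x - eN i)) ^ 2)
          + 2 * ENNReal.ofReal ((f (x - eN i) - f 0) ^ 2) := by
      have h2 : (2 : ℝ≥0∞) = ENNReal.ofReal 2 := by simp
      rw [h2, ← ENNReal.ofReal_mul (by positivity), ← ENNReal.ofReal_mul (by positivity),
        ← ENNReal.ofReal_add (by positivity) (by positivity)]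
      apply ENNReal.ofReal_le_ofReal
      nlinarith [sq_nonneg ((f x - f (x - eN i)) - (f (x - eN i) - f 0))]
    have h3 : ENNReal.ofReal ((f x - f (x - eN i)) ^ 2) ≤
        ENNReal.ofReal (1 / π x) * (ENNReal.ofReal (1 / cmin) * Asum π q f) := by
      have e : (f x - f (x - eN i)) ^ 2 = (1 / π x) * ((f x - f (x - eN i)) ^ 2 * π x) := by
        field_simp
      rw [e, ENNReal.ofReal_mul (by positivity)]
      gcongr
      refine (edge_le q π hπpos cmin hcmin hdeath f i x hi).trans ?_
      gcongr
      exact ENNReal.le_tsum (f := fun p : (Fin d → ℕ) × (Fin d → ℕ) =>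
        ENNReal.ofReal ((f p.1 - f p.2) ^ 2 * π p.1 * q p.1 p.2)) (x, x - eN i)
    calc _ ≤ _ := h1
      _ ≤ 2 * (ENNReal.ofReal (1 / π x) * (ENNReal.ofReal (1 / cmin) * Asum π q f))
          + 2 * (C * Asum π q f) := by gcongr; exact hC f
      _ = _ := by
        push_cast
        rw [ENNReal.ofReal, ENNReal.ofReal]
        ring

lemma tail_le {d : ℕ} (q : (Fin d → ℕ) → (Fin d → ℕ) → ℝ) (π : (Fin d → ℕ) → ℝ)
    (hπpos : ∀ x, 0 < π x) (cmin : ℝ) (hcmin : 0 < cmin)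
    (hdeath : ∀ (i : Fin d) (x : Fin d → ℕ), 1 ≤ x i → cmin ≤ q x (x - eN i))
    (M : ℕ) (hM : 1 ≤ M) (ρ : ℝ) (hρ : 0 ≤ ρ) (i : Fin d)
    (hdec : ∀ x : Fin d → ℕ, M ≤ x i → π x ≤ ρ * π (x - eN i))
    (f : (Fin d → ℕ) → ℝ) :
    ∑' x, (if M ≤ x i then ENNReal.ofReal ((f x - f 0) ^ 2 * π x) else 0) ≤
      2 * (ENNReal.ofReal (1 / cmin) * Asum π q f) +
      ENNReal.ofReal (2 * ρ) * ∑' x, ENNReal.ofReal ((f x - f 0) ^ 2 * π x) := by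
  have h2 : (2 : ℝ≥0∞) = ENNReal.ofReal 2 := by simp
  have step : ∀ x : Fin d → ℕ, (if M ≤ x i then ENNReal.ofReal ((f x - f 0) ^ 2 * π x) else 0) ≤
      2 * (if 1 ≤ x i then ENNReal.ofReal ((f x - f (x - eN i)) ^ 2 * π x) else 0) +
      ENNReal.ofReal (2 * ρ) * (if M ≤ x i then
        ENNReal.ofReal ((f (x - eN i) - f 0) ^ 2 * π (x - eN i)) else 0) := by
    intro x
    by_cases hx : M ≤ x i
    · rw [if_pos hx, if_pos (hM.trans hx), if_pos hx, h2]
      have hp := hπpos x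
      have hp' := hπpos (x - eN i)
      rw [← ENNReal.ofReal_mul (by positivity), ← ENNReal.ofReal_mul (by positivity),
        ← ENNReal.ofReal_add (by positivity) (by positivity)]
      apply ENNReal.ofReal_le_ofReal
      have e1 : (f x - f 0) ^ 2 ≤ 2 * (f x - f (x - eN i)) ^ 2 + 2 * (f (x - eN i) - f 0) ^ 2 := by
        nlinarith [sq_nonneg ((f x - f (x - eN i)) - (f (x - eN i) - f 0))]
      have e2 := mul_le_mul_of_nonneg_right e1 hp.le
      have e3 := mul_le_mul_of_nonneg_left (hdec x hx) (sq_nonneg (f (x - eN i) - f 0))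
      nlinarith
    · rw [if_neg hx]; exact zero_le
  refine (ENNReal.tsum_le_tsum step).trans ?_
  rw [ENNReal.tsum_add, ENNReal.tsum_mul_left, ENNReal.tsum_mul_left]
  gcongr ?_ + ?_
  · gcongr
    exact edge_sum_le q π hπpos cmin hcmin hdeath f i
  · refine mul_le_mul' le_rfl ?_
    rw [tsum_shift i (fun x => if M ≤ x i then
        ENNReal.ofReal ((f (x - eN i) - f 0) ^ 2 * π (x - eN i)) else 0)
        (fun x hx => by rw [if_neg (by omega)])]
    apply ENNReal.tsum_le_tsum
    intro y
    split_ifs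
    · rw [add_sub_eN]
    · exact zero_le

lemma var_le {d : ℕ} (π : (Fin d → ℕ) → ℝ)
    (hπpos : ∀ x, 0 < π x) (hπ1 : HasSum π 1) (f : (Fin d → ℕ) → ℝ)
    (hf : ∃ Kb, ∀ x, |f x| ≤ Kb) :
    Summable (fun x => (f x - f 0) ^ 2 * π x) ∧
      varPi π f ≤ ∑' x, (f x - f 0) ^ 2 * π x := by
  obtain ⟨B, hB⟩ := hf
  have hB0 : 0 ≤ B := (abs_nonneg _).trans (hB 0)
  have s1 : Summable (fun x => f x * π x) := by
    refine Summable.of_norm_bounded (hπ1.summable.mul_left B) (fun x => ?_)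
    rw [Real.norm_eq_abs, abs_mul, abs_of_pos (hπpos x)]
    exact mul_le_mul_of_nonneg_right (hB x) (hπpos x).le
  have s2 : Summable (fun x => f x ^ 2 * π x) := by
    refine Summable.of_norm_bounded (hπ1.summable.mul_left (B ^ 2)) (fun x => ?_)
    rw [Real.norm_eq_abs, abs_mul, abs_of_pos (hπpos x), abs_pow]
    exact mul_le_mul_of_nonneg_right (pow_le_pow_left₀ (abs_nonneg _) (hB x) 2) (hπpos x).le
  have h := (s2.hasSum.sub (s1.hasSum.mul_left (2 * f 0))).add (hπ1.mul_left (f 0 ^ 2))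
  have h' : HasSum (fun x => (f x - f 0) ^ 2 * π x)
      (∑' x, f x ^ 2 * π x - 2 * f 0 * ∑' x, f x * π x + f 0 ^ 2 * 1) := by
    have e : (fun x => (f x - f 0) ^ 2 * π x) =
        fun b => f b ^ 2 * π b - 2 * f 0 * (f b * π b) + f 0 ^ 2 * π b := by
      funext x
      ring
    rw [e]
    exact h
  refine ⟨h'.summable, ?_⟩
  rw [h'.tsum_eq, varPi]
  nlinarith [sq_nonneg ((∑' x, f x * π x) - f 0)]

/-- Corollary 2.6. -/
theorem poincare_of_superexp_decay_and_birth_death (d : ℕ)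
    (q : (Fin d → ℕ) → (Fin d → ℕ) → ℝ) (π : (Fin d → ℕ) → ℝ)
    (hq : ∀ x z, x ≠ z → 0 ≤ q x z)
    (hπpos : ∀ x, 0 < π x) (hπ1 : HasSum π 1)
    (K : ℕ) (hK : 0 < K) (α : ℝ) (hα : 0 < α)
    (hdecay : ∀ (i : Fin d) (x : Fin d → ℕ), K ≤ x i →
      π x / π (x - eN i) ≤ 1 / (x i : ℝ) ^ α)
    (cmin : ℝ) (hcmin : 0 < cmin)
    (hbirth : ∀ (i : Fin d) (x : Fin d → ℕ), cmin ≤ q x (x + eN i))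
    (hdeath : ∀ (i : Fin d) (x : Fin d → ℕ), 1 ≤ x i → cmin ≤ q x (x - eN i)) :
    ∃ C > 0, ∀ f : (Fin d → ℕ) → ℝ, (∃ Kb, ∀ x, |f x| ≤ Kb) →
      ENNReal.ofReal (C * varPi π f) ≤ Estar π q f := by
  classical
  -- choice of the cutoff
  set ρ : ℝ := 1 / (4 * (d + 1)) with hρdef
  have hρ : 0 < ρ := by positivity
  obtain ⟨M, hMK, hM⟩ : ∃ M : ℕ, K ≤ M ∧ ∀ n : ℕ, M ≤ n → 4 * ((d : ℝ) + 1) ≤ (n : ℝ) ^ α := by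
    have ht := ((tendsto_rpow_atTop hα).comp
      (tendsto_natCast_atTop_atTop (R := ℝ))).eventually_ge_atTop (4 * ((d : ℝ) + 1))
    obtain ⟨M, hM⟩ := Filter.eventually_atTop.1 ht
    exact ⟨max K M, le_max_left _ _, fun n hn => hM n ((le_max_right _ _).trans hn)⟩
  have hM1 : 1 ≤ M := by omega
  have hdec : ∀ (i : Fin d) (x : Fin d → ℕ), M ≤ x i → π x ≤ ρ * π (x - eN i) := by
    intro i x hx
    have h1 := hdecay i x (hMK.trans hx)
    rw [← div_le_iff₀ (hπpos _)]
    refine h1.trans ?_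
    exact one_div_le_one_div_of_le (by positivity) (hM _ hx)
  -- box constants
  have hbox : ∀ x : Fin d → ℕ, ∃ C : ℝ≥0, ∀ f : (Fin d → ℕ) → ℝ,
      ENNReal.ofReal ((f x - f 0) ^ 2) ≤ C * Asum π q f :=
    fun x => point_le q π hπpos cmin hcmin hdeath _ x rfl
  choose Cx hCx using hbox
  set B : Finset (Fin d → ℕ) := Fintype.piFinset (fun _ => Finset.range M) with hB
  set CB : ℝ≥0 := ∑ x ∈ B, Cx x * Real.toNNReal (π x) with hCB
  set C' : ℝ := CB + 2 * d / cmin with hC'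
  have hC'0 : 0 ≤ C' := by positivity
  refine ⟨1 / (4 * C' + 1), by positivity, fun f hf => ?_⟩
  obtain ⟨hsum, hvar⟩ := var_le π hπpos hπ1 f hf
  have hE : Estar π q f = Asum π q f / 2 := rfl
  rw [hE]
  set A := Asum π q f with hA
  set G : (Fin d → ℕ) → ℝ≥0∞ := fun x => ENNReal.ofReal ((f x - f 0) ^ 2 * π x) with hG
  set t : ℝ := ∑' x, (f x - f 0) ^ 2 * π x with ht
  have hnn : ∀ x, 0 ≤ (f x - f 0) ^ 2 * π x := fun x => mul_nonneg (sq_nonneg _) (hπpos x).le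
  have ht0 : 0 ≤ t := tsum_nonneg hnn
  have hT : ∑' x, G x = ENNReal.ofReal t := (ENNReal.ofReal_tsum_of_nonneg hnn hsum).symm
  have hmain : ENNReal.ofReal t ≤ CB * A +
      ∑ i : Fin d, (2 * (ENNReal.ofReal (1 / cmin) * A) +
        ENNReal.ofReal (2 * ρ) * ENNReal.ofReal t) := by
    rw [← hT]
    have hpt : ∀ x, G x ≤ (if x ∈ B then G x else 0) + ∑ i : Fin d, (if M ≤ x i then G x else 0) := by
      intro x
      by_cases hx : x ∈ B
      · rw [if_pos hx]; exact le_self_add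
      · have : ∃ i, M ≤ x i := by
          by_contra! hcon
          exact hx (by simpa [hB, Fintype.mem_piFinset] using hcon)
        obtain ⟨i, hi⟩ := this
        refine le_trans ?_ le_add_self
        refine le_trans ?_ (Finset.single_le_sum
          (f := fun i : Fin d => if M ≤ x i then G x else 0)
          (fun _ _ => zero_le) (Finset.mem_univ i))
        simp [hi]
    refine (ENNReal.tsum_le_tsum hpt).trans ?_
    rw [ENNReal.tsum_add, Summable.tsum_finsetSum (fun _ _ => ENNReal.summable)]
    gcongr with i hi
    · rw [tsum_eq_sum (s := B) (fun x hx => if_neg hx), hCB]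
      push_cast
      rw [Finset.sum_mul]
      apply Finset.sum_le_sum
      intro x hx
      rw [if_pos hx, hG]
      simp only
      rw [ENNReal.ofReal_mul (sq_nonneg _), mul_right_comm]
      exact mul_le_mul' (hCx x f) le_rfl
    · exact tail_le q π hπpos cmin hcmin hdeath M hM1 ρ hρ.le i (hdec i) f
  by_cases hAtop : A = ⊤
  · rw [hAtop, ENNReal.top_div_of_ne_top (by simp)]; exact le_top
  have hAr : A = ENNReal.ofReal A.toReal := (ENNReal.ofReal_toReal hAtop).symm
  set a := A.toReal with ha
  have ha0 : 0 ≤ a := ENNReal.toReal_nonneg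
  have h2 : (2 : ℝ≥0∞) = ENNReal.ofReal 2 := by simp
  have hCBr : (CB : ℝ≥0∞) = ENNReal.ofReal (CB : ℝ) := by simp
  rw [Finset.sum_const, Finset.card_univ, Fintype.card_fin, nsmul_eq_mul, hAr, hCBr, h2,
    ← ENNReal.ofReal_natCast d,
    ← ENNReal.ofReal_mul (by positivity), ← ENNReal.ofReal_mul (by positivity),
    ← ENNReal.ofReal_mul (by positivity), ← ENNReal.ofReal_mul (by positivity),
    ← ENNReal.ofReal_add (by positivity) (by positivity), ← ENNReal.ofReal_mul (by positivity),
    ← ENNReal.ofReal_add (by positivity) (by positivity),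
    ENNReal.ofReal_le_ofReal_iff (by positivity)] at hmain
  rw [hAr, h2, ← ENNReal.ofReal_div_of_pos (by norm_num)]
  apply ENNReal.ofReal_le_ofReal
  have hρd : (d : ℝ) * (2 * ρ) ≤ 1 / 2 := by
    rw [hρdef]
    have : (0 : ℝ) ≤ d := by positivity
    field_simp
    linarith
  have key : t ≤ C' * a + t / 2 := by
    have e1 : (d : ℝ) * (2 * ρ) * t ≤ 1 / 2 * t := mul_le_mul_of_nonneg_right hρd ht0
    have e2 : (CB : ℝ) * a + d * (2 * (1 / cmin * a) + 2 * ρ * t)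
        = C' * a + d * (2 * ρ) * t := by rw [hC']; ring
    rw [e2] at hmain
    linarith
  rw [one_div, ← div_eq_inv_mul, div_le_iff₀ (by positivity)]
  nlinarith
end

section
/- Corollary 2.8 (relaxed, catalyzed version). Let S = ℤ^d_{≥0} and suppose: (1) π(x) = ∏_{i=1}^d π_i(x_i) where each π_i is a probability distribution on ℤ_{≥0} with π_i(n) > 0 for all n, and there exist an integer K ≥ 1 and α > 0 such that π_i(n)/π_i(n−1) ≤ 1/n^α whenever n ≥ K; (2) there exist c_min > 0 and a nonempty subset J_0 ⊆ {1,…,d} such that for each i ∈ J_0, q(x,x+e_i) ≥ c_min for all x ∈ ℤ^d_{≥0} and q(x,x−e_i) ≥ c_min for all x with x_i ≥ 1; (3) there exist pairwise disjoint subsets J_1,…,J_m of {1,…,d} such that {J_0,J_1,…,J_m} is a partition of {1,…,d}, and an integer N ≥ 1, such that for each ℓ ≥ 1 and each i ∈ J_ℓ: q(x,x+e_i) ≥ c_min whenever x_j ≥ N for some j ∈ J_0 ∪ ⋯ ∪ J_{ℓ−1}, and q(x,x−e_i) ≥ c_min whenever x_i ≥ 1 and x_j ≥ N for some j ∈ J_0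 ∪ ⋯ ∪ J_{ℓ−1}. Then there exists a constant C > 0 such that for every bounded function f : ℤ^d_{≥0} → ℝ one has E*(f) ≥ C · Var_π(f). -/
open scoped ENNReal

lemma eN_inj {d : ℕ} (i : Fin d) : Function.Injective (fun x : Fin d → ℕ => x + eN i) :=
  fun _ _ h => add_right_cancel h

lemma shift_le {d : ℕ} (i : Fin d) (G : (Fin d → ℕ) → ℝ) (h0 : ∀ x, 0 ≤ G x) (hs : Summable G) :
    ∑' x, G (x + eN i) ≤ ∑' x, G x :=
  Summable.tsum_le_tsum_of_inj (fun x : Fin d → ℕ => x + eN i) (eN_inj i) (fun c _ => h0 c)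
    (fun _ => le_rfl) (hs.comp_injective (eN_inj i)) hs

lemma shift_eq {d : ℕ} (i : Fin d) (G : (Fin d → ℕ) → ℝ) (hs : Summable G) :
    ∑' x, G x = (∑' x, if x i = 0 then G x else 0) + ∑' x, G (x + eN i) := by
  have h1 : Summable (fun x => if x i = 0 then G x else 0) := by
    have := hs.indicator {x | x i = 0}
    refine this.congr (fun x => ?_)
    by_cases hx : x i = 0 <;> simp [hx]
  have h2 : Summable (fun x => if x i = 0 then 0 else G x) := by
    have := hs.sub h1
    refine this.congr (fun x => ?_)
    by_cases hx : x i = 0 <;> simp [hx]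
  have h3 : ∑' x, G (x + eN i) = ∑' x, (if x i = 0 then 0 else G x) := by
    rw [← (eN_inj i).tsum_eq (f := fun x => if x i = 0 then 0 else G x)]
    · apply tsum_congr
      intro x
      simp [eN]
    · intro x hx
      have hxi : x i ≠ 0 := by
        intro h
        simp [h] at hx
      refine ⟨x - eN i, ?_⟩
      funext j
      by_cases hj : j = i
      · subst hj
        simp [eN]; omega
      · simp [eN, hj]
  rw [h3, ← h1.tsum_add h2]
  apply tsum_congr
  intro x
  by_cases hx : x i = 0 <;> simp [hx]

lemma summ {d : ℕ} {w : (Fin d → ℕ) → ℝ} (hw : Summable w) (u F : (Fin d → ℕ) → ℝ)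
    (hu0 : ∀ x, 0 ≤ u x) (hu : ∀ x, u x ≤ w x) (B : ℝ) (hF0 : ∀ x, 0 ≤ F x) (hF : ∀ x, F x ≤ B) :
    Summable (fun x => u x * F x) := by
  refine Summable.of_nonneg_of_le (fun x => mul_nonneg (hu0 x) (hF0 x)) (fun x => ?_)
    (hw.mul_right B)
  exact mul_le_mul (hu x) (hF x) (hF0 x) ((hu0 x).trans (hu x))

/-- zeroing coordinate i -/
def Tz {d : ℕ} (i : Fin d) (x : Fin d → ℕ) : Fin d → ℕ := fun j => if j = i then 0 else x j

lemma Tz_shift {d : ℕ} (i : Fin d) (x : Fin d → ℕ) : Tz i (x + eN i) = Tz i x := by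
  funext j
  by_cases hj : j = i <;> simp [Tz, eN, hj]

lemma Tz_zero {d : ℕ} (i : Fin d) (x : Fin d → ℕ) (h : x i = 0) : Tz i x = x := by
  funext j
  by_cases hj : j = i <;> simp [Tz, hj, h]

lemma contr {d : ℕ} {w : (Fin d → ℕ) → ℝ} (hw : Summable w) (hw0 : ∀ x, 0 ≤ w x)
    (i : Fin d) (hdec : ∀ x, w (x + eN i) ≤ w x / 4) (F : (Fin d → ℕ) → ℝ) (B : ℝ)
    (hF0 : ∀ x, 0 ≤ F x) (hF : ∀ x, F x ≤ B) :
    ∑' x, w x * F (Tz i x) ≤ 2 * ∑' x, w x * F x := by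
  have s1 := summ hw w (fun x => F (Tz i x)) hw0 (fun _ => le_rfl) B (fun x => hF0 _) (fun x => hF _)
  have s2 := summ hw w F hw0 (fun _ => le_rfl) B hF0 hF
  have e := shift_eq i _ s1
  have a1 : (∑' x, if x i = 0 then w x * F (Tz i x) else 0) ≤ ∑' x, w x * F x := by
    refine Summable.tsum_le_tsum (fun x => ?_) ?_ s2
    · by_cases hx : x i = 0
      · simp [hx, Tz_zero i x hx]
      · simpa [hx] using mul_nonneg (hw0 x) (hF0 x)
    · refine (s1.indicator {x | x i = 0}).congr (fun x => ?_)
      by_cases hx : x i = 0 <;> simp [hx]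
  have a2 : ∑' x, w (x + eN i) * F (Tz i (x + eN i)) ≤ (1 / 4) * ∑' x, w x * F (Tz i x) := by
    rw [← tsum_mul_left]
    refine Summable.tsum_le_tsum (fun x => ?_) (s1.comp_injective (eN_inj i)) (s1.mul_left _)
    rw [Tz_shift]
    have := mul_le_mul_of_nonneg_right (hdec x) (hF0 (Tz i x))
    linarith
  have n1 : 0 ≤ ∑' x, w x * F x := tsum_nonneg (fun x => mul_nonneg (hw0 x) (hF0 x))
  linarith

lemma sqb {X : Type*} {f : X → ℝ} {B : ℝ} (hf : ∀ x, |f x| ≤ B) (x y : X) :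
    (f x - f y) ^ 2 ≤ 4 * B ^ 2 := by
  have h1 := abs_le.1 (hf x)
  have h2 := abs_le.1 (hf y)
  nlinarith

/-- Hardy-type inequality in direction `i`. -/
lemma hardy {d : ℕ} {w : (Fin d → ℕ) → ℝ} (hw : Summable w) (hw0 : ∀ x, 0 ≤ w x)
    (i : Fin d) (hdec : ∀ x, w (x + eN i) ≤ w x / 4) (f : (Fin d → ℕ) → ℝ) (B : ℝ)
    (hf : ∀ x, |f x| ≤ B) :
    ∑' x, w x * (f x - f (Tz i x)) ^ 2 ≤ 4 * ∑' x, w (x + eN i) * (f (x + eN i) - f x) ^ 2 := by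
  have hle : ∀ x, w (x + eN i) ≤ w x := fun x => by linarith [hdec x, hw0 x]
  have s1 := summ hw w (fun x => (f x - f (Tz i x)) ^ 2) hw0 (fun _ => le_rfl) _
    (fun x => sq_nonneg _) (fun x => sqb hf _ _)
  have s2 := summ hw (fun x => w (x + eN i)) (fun x => (f (x + eN i) - f x) ^ 2) (fun x => hw0 _)
    hle _ (fun x => sq_nonneg _) (fun x => sqb hf _ _)
  have e := shift_eq i _ s1
  have a1 : (∑' x, if x i = 0 then w x * (f x - f (Tz i x)) ^ 2 else 0) = 0 := by
    rw [← tsum_zero (α := ℝ) (β := Fin d → ℕ)]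
    refine tsum_congr (fun x => ?_)
    by_cases hx : x i = 0
    · simp [hx, Tz_zero i x hx]
    · simp [hx]
  have a2 : ∑' x, w (x + eN i) * (f (x + eN i) - f (Tz i (x + eN i))) ^ 2 ≤
      (1 / 2) * ∑' x, w x * (f x - f (Tz i x)) ^ 2
        + 2 * ∑' x, w (x + eN i) * (f (x + eN i) - f x) ^ 2 := by
    rw [← tsum_mul_left, ← tsum_mul_left, ← (s1.mul_left _).tsum_add (s2.mul_left _)]
    refine Summable.tsum_le_tsum (fun x => ?_) (s1.comp_injective (eN_inj i))
      ((s1.mul_left _).add (s2.mul_left _))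
    rw [Tz_shift]
    have h1 := mul_le_mul_of_nonneg_right (hdec x) (sq_nonneg (f x - f (Tz i x)))
    have h2 : (f (x + eN i) - f (Tz i x)) ^ 2 ≤
      2 * (f x - f (Tz i x)) ^ 2 + 2 * (f (x + eN i) - f x) ^ 2 := by
      nlinarith [sq_nonneg ((f (x + eN i) - f x) - (f x - f (Tz i x)))]
    have h3 := mul_le_mul_of_nonneg_left h2 (hw0 (x + eN i))
    linarith
  rw [a1] at e
  linarith

/-- zeroing the coordinates in s -/
def Ts {d : ℕ} (s : Finset (Fin d)) (x : Fin d → ℕ) : Fin d → ℕ := fun j => if j ∈ s then 0 else x j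

lemma Ts_insert {d : ℕ} (s : Finset (Fin d)) (i : Fin d) (x : Fin d → ℕ) :
    Ts (insert i s) x = Ts s (Tz i x) := by
  funext j
  by_cases hj : j = i <;> by_cases hs : j ∈ s <;> simp [Ts, Tz, hj, hs]

lemma allcoord {d : ℕ} {w : (Fin d → ℕ) → ℝ} (hw : Summable w) (hw0 : ∀ x, 0 ≤ w x)
    (hdec : ∀ i x, w (x + eN i) ≤ w x / 4) (s : Finset (Fin d)) :
    ∃ C : ℝ, 0 ≤ C ∧ ∀ (f : (Fin d → ℕ) → ℝ) (B : ℝ), (∀ x, |f x| ≤ B) →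
    ∑' x, w x * (f x - f (Ts s x)) ^ 2 ≤
      C * ∑ i, ∑' x, w (x + eN i) * (f (x + eN i) - f x) ^ 2 := by
  induction s using Finset.induction_on with
  | empty =>
    refine ⟨0, le_rfl, fun f B hf => ?_⟩
    have h0 : ∀ x : Fin d → ℕ, Ts ∅ x = x := fun x => by funext l; simp [Ts]
    simp [h0]
  | insert i s hi ih =>
    obtain ⟨C, hC, ih⟩ := ih
    refine ⟨8 + 4 * C, by linarith, fun f B hf => ?_⟩
    have ih := ih f B hf
    have s1 := summ hw w (fun x => (f x - f (Tz i x)) ^ 2) hw0 (fun _ => le_rfl) _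
      (fun x => sq_nonneg _) (fun x => sqb hf _ _)
    have s2 := summ hw w (fun x => (f (Tz i x) - f (Ts s (Tz i x))) ^ 2) hw0 (fun _ => le_rfl) _
      (fun x => sq_nonneg _) (fun x => sqb hf _ _)
    have s3 := summ hw w (fun x => (f x - f (Ts (insert i s) x)) ^ 2) hw0 (fun _ => le_rfl) _
      (fun x => sq_nonneg _) (fun x => sqb hf _ _)
    have a1 := hardy hw hw0 i (hdec i) f B hf
    have a2 := contr hw hw0 i (hdec i) (fun x => (f x - f (Ts s x)) ^ 2) _
      (fun x => sq_nonneg _) (fun x => sqb hf _ _)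
    have a3 : ∑' x, w x * (f x - f (Ts (insert i s) x)) ^ 2 ≤
        2 * ∑' x, w x * (f x - f (Tz i x)) ^ 2
        + 2 * ∑' x, w x * (f (Tz i x) - f (Ts s (Tz i x))) ^ 2 := by
      rw [← tsum_mul_left, ← tsum_mul_left, ← (s1.mul_left _).tsum_add (s2.mul_left _)]
      refine Summable.tsum_le_tsum (fun x => ?_) s3 ((s1.mul_left _).add (s2.mul_left _))
      rw [Ts_insert]
      have h2 : (f x - f (Ts s (Tz i x))) ^ 2 ≤
        2 * (f x - f (Tz i x)) ^ 2 + 2 * (f (Tz i x) - f (Ts s (Tz i x))) ^ 2 := by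
        nlinarith [sq_nonneg ((f x - f (Tz i x)) - (f (Tz i x) - f (Ts s (Tz i x))))]
      have h3 := mul_le_mul_of_nonneg_left h2 (hw0 x)
      linarith
    have a4 : ∑' x, w (x + eN i) * (f (x + eN i) - f x) ^ 2 ≤
        ∑ i, ∑' x, w (x + eN i) * (f (x + eN i) - f x) ^ 2 :=
      Finset.single_le_sum (f := fun i => ∑' x, w (x + eN i) * (f (x + eN i) - f x) ^ 2)
        (fun j _ => tsum_nonneg (fun x => mul_nonneg (hw0 _) (sq_nonneg _))) (Finset.mem_univ i)
    linarith

/-- path comparison through the catalyst coordinate `j`. -/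
lemma catal {d : ℕ} {w : (Fin d → ℕ) → ℝ} (hw : Summable w) (hw0 : ∀ x, 0 ≤ w x)
    (hdec : ∀ i x, w (x + eN i) ≤ w x / 4) (i j : Fin d) (hij : i ≠ j) (R : ℕ → ℝ)
    (hR0 : ∀ k, 0 ≤ R k) (hR : ∀ x, w x ≤ R (x j) * w (x + eN j)) (N : ℕ) :
    ∃ C : ℝ, 0 ≤ C ∧ ∀ (f : (Fin d → ℕ) → ℝ) (B : ℝ), (∀ x, |f x| ≤ B) →
    ∑' x, w (x + eN i) * (f (x + eN i) - f x) ^ 2 ≤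
      C * (∑' x, w x * (f (x + eN j) - f x) ^ 2 +
       ∑' x, (if N ≤ x j then w (x + eN i) else 0) * (f (x + eN i) - f x) ^ 2) := by
  induction N with
  | zero =>
    refine ⟨1, by norm_num, fun f B hf => ?_⟩
    have : 0 ≤ ∑' x, w x * (f (x + eN j) - f x) ^ 2 :=
      tsum_nonneg (fun x => mul_nonneg (hw0 _) (sq_nonneg _))
    simp only [Nat.zero_le, if_true]
    linarith
  | succ k ih =>
    obtain ⟨C, hC, ih⟩ := ih
    refine ⟨C * (7 + 3 * R k), mul_nonneg hC (by linarith [hR0 k]), fun f B hf => ?_⟩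
    refine (ih f B hf).trans ?_
    rw [mul_assoc]
    refine mul_le_mul_of_nonneg_left ?_ hC
    have hle : ∀ x, w (x + eN i) ≤ w x := fun x => by linarith [hdec i x, hw0 x]
    have sD := summ hw w (fun x => (f (x + eN j) - f x) ^ 2) hw0 (fun _ => le_rfl) _
      (fun x => sq_nonneg _) (fun x => sqb hf _ _)
    have sE : ∀ k, Summable (fun x => (if k ≤ x j then w (x + eN i) else 0) *
        (f (x + eN i) - f x) ^ 2) := fun k =>
      summ hw (fun x => if k ≤ x j then w (x + eN i) else 0) (fun x => (f (x + eN i) - f x) ^ 2)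
        (fun x => by split_ifs; exacts [hw0 _, le_rfl])
        (fun x => by split_ifs; exacts [hle _, hw0 _]) _
        (fun x => sq_nonneg _) (fun x => sqb hf _ _)
    have E0 : ∀ k x, 0 ≤ (if k ≤ x j then w (x + eN i) else 0) * (f (x + eN i) - f x) ^ 2 :=
      fun k x => mul_nonneg (by split_ifs; exacts [hw0 _, le_rfl]) (sq_nonneg _)
    have b1 := shift_le i _ (fun x => mul_nonneg (hw0 x) (sq_nonneg (f (x + eN j) - f x))) sD
    have b2 := shift_le j _ (E0 (k + 1)) (sE (k + 1))
    have sD' := sD.comp_injective (eN_inj i)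
    have sE' := (sE (k + 1)).comp_injective (eN_inj j)
    simp only [Function.comp_def] at sD' sE'
    have main : ∑' x, (if k ≤ x j then w (x + eN i) else 0) * (f (x + eN i) - f x) ^ 2 ≤
        ∑' x, ((if k + 1 ≤ x j then w (x + eN i) else 0) * (f (x + eN i) - f x) ^ 2 +
          (3 * (w x * (f (x + eN j) - f x) ^ 2) +
          (3 * (w (x + eN i) * (f (x + eN i + eN j) - f (x + eN i)) ^ 2) +
          3 * R k * ((if k + 1 ≤ (x + eN j) j then w (x + eN j + eN i) else 0) *
            (f (x + eN j + eN i) - f (x + eN j)) ^ 2)))) := by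
      refine Summable.tsum_le_tsum (fun x => ?_) (sE k)
        ((sE _).add ((sD.mul_left _).add ((sD'.mul_left _).add (sE'.mul_left _))))
      have p1 : 0 ≤ w x * (f (x + eN j) - f x) ^ 2 := mul_nonneg (hw0 _) (sq_nonneg _)
      have p2 : 0 ≤ w (x + eN i) * (f (x + eN i + eN j) - f (x + eN i)) ^ 2 :=
        mul_nonneg (hw0 _) (sq_nonneg _)
      have p3 := mul_nonneg (mul_nonneg zero_le_three (hR0 k)) (E0 (k + 1) (x + eN j))
      rcases lt_trichotomy (x j) k with h | h | h
      · have h1 : ¬ k ≤ x j := by omega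
        have h2 : ¬ k + 1 ≤ x j := by omega
        rw [if_neg h1, if_neg h2]
        linarith
      · have h1 : k ≤ x j := by omega
        have h2 : ¬ k + 1 ≤ x j := by omega
        have h3 : k + 1 ≤ (x + eN j) j := by simp [eN]; omega
        rw [if_pos h1, if_neg h2, if_pos h3]
        have hc : x + eN j + eN i = x + eN i + eN j := by abel
        have hRx := hR (x + eN i)
        have hxj : (x + eN i) j = k := by simp [eN, hij.symm, h]
        rw [hxj] at hRx
        rw [hc]
        have t : (f (x + eN i) - f x) ^ 2 ≤ 3 * (f (x + eN j) - f x) ^ 2 +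
            3 * (f (x + eN i + eN j) - f (x + eN i)) ^ 2 +
            3 * (f (x + eN i + eN j) - f (x + eN j)) ^ 2 := by
          generalize f (x + eN i) = a
          generalize f (x + eN j) = b
          generalize f (x + eN i + eN j) = c
          generalize f x = e
          nlinarith [sq_nonneg ((b - e) + (c - a)), sq_nonneg ((b - e) - (c - b)),
            sq_nonneg ((c - b) + (c - a))]
        have t1 := mul_le_mul_of_nonneg_left t (hw0 (x + eN i))
        have t2 := mul_le_mul_of_nonneg_right (hle x) (sq_nonneg (f (x + eN j) - f x))
        have t3 := mul_le_mul_of_nonneg_right hRx (sq_nonneg (f (x + eN i + eN j) - f (x + eN j)))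
        linarith
      · have h1 : k ≤ x j := by omega
        have h2 : k + 1 ≤ x j := by omega
        rw [if_pos h1, if_pos h2]
        linarith
    rw [(sE _).tsum_add ((sD.mul_left _).add ((sD'.mul_left _).add (sE'.mul_left _))),
      (sD.mul_left _).tsum_add ((sD'.mul_left _).add (sE'.mul_left _)),
      (sD'.mul_left _).tsum_add (sE'.mul_left _), tsum_mul_left, tsum_mul_left, tsum_mul_left]
      at main
    have hD0 : 0 ≤ ∑' x, w x * (f (x + eN j) - f x) ^ 2 :=
      tsum_nonneg (fun x => mul_nonneg (hw0 _) (sq_nonneg _))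
    have hE0 := tsum_nonneg (L := SummationFilter.unconditional _) (E0 (k + 1))
    have b3 := mul_le_mul_of_nonneg_left b2 (mul_nonneg zero_le_three (hR0 k))
    have b4 := mul_nonneg (hR0 k) hD0
    linarith

lemma exists_w (p : ℕ → ℝ) (hp : ∀ n, 0 < p n) (M : ℕ) (hM : ∀ n, M ≤ n → p (n + 1) ≤ p n / 4) :
    ∃ (w : ℕ → ℝ) (C : ℝ), 0 < C ∧ (∀ n, p n ≤ w n) ∧ (∀ n, w n ≤ C * p n) ∧
      ∀ n, w (n + 1) ≤ w n / 4 := by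
  set B := ∑ k ∈ Finset.range (M + 1), p k with hB
  have hpB : ∀ n, n ≤ M → p n ≤ B := fun n hn =>
    Finset.single_le_sum (f := p) (fun k _ => (hp k).le) (by simp; omega)
  have hB0 : 0 < B := (hp 0).trans_le (hpB 0 (by omega))
  set w : ℕ → ℝ := fun n => if n < M then 4 ^ (M - n) * B else p n with hw
  have hw0 : ∀ n, 0 ≤ w n := fun n => by
    simp only [hw]; split_ifs
    · positivity
    · exact (hp n).le
  have hC0 : 0 ≤ ∑ n ∈ Finset.range M, w n / p n :=
    Finset.sum_nonneg (fun n _ => div_nonneg (hw0 n) (hp n).le)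
  refine ⟨w, 1 + ∑ n ∈ Finset.range M, w n / p n, by linarith, fun n => ?_, fun n => ?_,
    fun n => ?_⟩
  · simp only [hw]; split_ifs with h
    · have := hpB n h.le
      have h4 : (1 : ℝ) ≤ 4 ^ (M - n) := one_le_pow₀ (by norm_num)
      nlinarith
    · exact le_rfl
  · by_cases h : n < M
    · have : w n / p n ≤ ∑ n ∈ Finset.range M, w n / p n :=
        Finset.single_le_sum (f := fun n => w n / p n)
          (fun n _ => div_nonneg (hw0 n) (hp n).le) (by simpa using h)
      rw [← div_le_iff₀ (hp n)]
      linarith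
    · have : w n = p n := by simp [hw, h]
      rw [this]
      nlinarith [hp n]
  · simp only [hw]
    by_cases h : n + 1 < M
    · have h' : n < M := by omega
      have e : M - n = (M - (n + 1)) + 1 := by omega
      rw [if_pos h, if_pos h', e, pow_succ]
      linarith
    · by_cases h' : n < M
      · have e : M - n = 1 := by omega
        rw [if_neg h, if_pos h', e]
        have := hpB (n + 1) (by omega)
        linarith
      · rw [if_neg h, if_neg h']
        exact hM n (by omega)

lemma hasSum_pi (d : ℕ) (p : Fin d → ℕ → ℝ) (hp : ∀ i n, 0 < p i n) (h1 : ∀ i, HasSum (p i) 1) :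
    HasSum (fun x : Fin d → ℕ => ∏ i, p i (x i)) 1 := by
  induction d with
  | zero => simp
  | succ d ih =>
    have h := ih (fun i => p i.succ) (fun i n => hp _ _) (fun i => h1 _)
    have hs := (h1 0).summable.mul_of_nonneg h.summable (fun n => (hp 0 n).le)
      (fun x => Finset.prod_nonneg (fun i _ => (hp _ _).le))
    have hm := (h1 0).mul h hs
    rw [one_mul] at hm
    rw [← (Fin.consEquiv (fun _ : Fin (d + 1) => ℕ)).hasSum_iff]
    refine hm.congr_fun (fun y => ?_)
    simp [Fin.consEquiv, Fin.prod_univ_succ]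

lemma var_le_s2 {X : Type*} (p f : X → ℝ) (hp : ∀ x, 0 ≤ p x) (h1 : HasSum p 1) (B : ℝ)
    (hf : ∀ x, |f x| ≤ B) (c : ℝ) : varPi p f ≤ ∑' x, p x * (f x - c) ^ 2 := by
  have s1 : Summable (fun x => f x * p x) := by
    refine Summable.of_norm_bounded (h1.summable.mul_left B) (fun x => ?_)
    rw [norm_mul, Real.norm_eq_abs, Real.norm_eq_abs, abs_of_nonneg (hp x)]
    exact mul_le_mul_of_nonneg_right (hf x) (hp x)
  have s2 : Summable (fun x => f x ^ 2 * p x) := by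
    refine Summable.of_norm_bounded (h1.summable.mul_left (B ^ 2)) (fun x => ?_)
    rw [norm_mul, Real.norm_eq_abs, Real.norm_eq_abs, abs_of_nonneg (hp x), abs_pow]
    exact mul_le_mul_of_nonneg_right (pow_le_pow_left₀ (abs_nonneg _) (hf x) 2) (hp x)
  have e : HasSum (fun x => p x * (f x - c) ^ 2)
      ((∑' x, f x ^ 2 * p x) - 2 * c * (∑' x, f x * p x) + c ^ 2 * 1) := by
    refine ((s2.hasSum.sub (s1.hasSum.mul_left (2 * c))).add (h1.mul_left (c ^ 2))).congr_fun ?_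
    intro x; ring
  rw [e.tsum_eq, varPi]
  nlinarith [sq_nonneg ((∑' x, f x * p x) - c)]

lemma ev_ratio (p : ℕ → ℝ) (hp : ∀ n, 0 < p n) (K : ℕ) (α : ℝ) (hα : 0 < α)
    (h : ∀ n : ℕ, K ≤ n → p n / p (n - 1) ≤ 1 / (n : ℝ) ^ α) :
    ∃ M, ∀ n, M ≤ n → p (n + 1) ≤ p n / 4 := by
  have ht : Filter.Tendsto (fun n : ℕ => (n : ℝ) ^ α) Filter.atTop Filter.atTop :=
    (tendsto_rpow_atTop hα).comp tendsto_natCast_atTop_atTop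
  obtain ⟨M, hM⟩ := Filter.eventually_atTop.1 (ht.eventually_ge_atTop 4)
  refine ⟨max M K, fun n hn => ?_⟩
  have h1 := h (n + 1) (by omega)
  have h2 := hM (n + 1) (by omega)
  have h3 : 1 / ((n + 1 : ℕ) : ℝ) ^ α ≤ 1 / 4 := one_div_le_one_div_of_le (by norm_num) h2
  have h4 := h1.trans h3
  rw [Nat.add_sub_cancel, div_le_iff₀ (hp n)] at h4
  linarith

lemma prod_shift {d : ℕ} (g : Fin d → ℕ → ℝ) (i : Fin d) (x : Fin d → ℕ) :
    ∏ l, g l ((x + eN i) l) = g i (x i + 1) * ∏ l ∈ Finset.univ.erase i, g l (x l) := by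
  rw [← Finset.mul_prod_erase Finset.univ _ (Finset.mem_univ i)]
  congr 1
  · simp [eN]
  · refine Finset.prod_congr rfl (fun l hl => ?_)
    have : l ≠ i := Finset.ne_of_mem_erase hl
    simp [eN, this]

/-- Corollary 2.8 (relaxed, catalyzed version). -/
theorem poincare_relaxed (d : ℕ)
    (q : (Fin d → ℕ) → (Fin d → ℕ) → ℝ)
    (hq : ∀ x z, x ≠ z → 0 ≤ q x z)
    -- condition 1: product form stationary distribution with super-exponential decay
    (πi : Fin d → ℕ → ℝ)
    (hπipos : ∀ i n, 0 < πi i n) (hπi1 : ∀ i, HasSum (πi i) 1)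
    (π : (Fin d → ℕ) → ℝ) (hπprod : ∀ x, π x = ∏ i, πi i (x i))
    (K : ℕ) (hK : 1 ≤ K) (α : ℝ) (hα : 0 < α)
    (hdecay : ∀ (i : Fin d) (n : ℕ), K ≤ n → πi i n / πi i (n - 1) ≤ 1 / (n : ℝ) ^ α)
    -- condition 2: uncatalyzed births and deaths for indices in J 0
    (cmin : ℝ) (hcmin : 0 < cmin)
    (m : ℕ) (J : Fin (m + 1) → Finset (Fin d))
    (hdisj : ∀ k l, k ≠ l → Disjoint (J k) (J l))
    (hcover : ∀ i, ∃ k, i ∈ J k)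
    (hJ0ne : (J 0).Nonempty)
    (hJ0 : ∀ i ∈ J 0,
      (∀ x : Fin d → ℕ, cmin ≤ q x (x + eN i)) ∧
      (∀ x : Fin d → ℕ, 1 ≤ x i → cmin ≤ q x (x - eN i)))
    -- condition 3: catalyzed births and deaths for indices in J ℓ, ℓ ≥ 1
    (N : ℕ) (hN : 1 ≤ N)
    (hJl : ∀ k : Fin (m + 1), k ≠ 0 → ∀ i ∈ J k,
      (∀ x : Fin d → ℕ, (∃ l, l < k ∧ ∃ j ∈ J l, N ≤ x j) → cmin ≤ q x (x + eN i)) ∧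
      (∀ x : Fin d → ℕ, 1 ≤ x i → (∃ l, l < k ∧ ∃ j ∈ J l, N ≤ x j) →
        cmin ≤ q x (x - eN i))) :
    ∃ C > 0, ∀ f : (Fin d → ℕ) → ℝ, (∃ Kb, ∀ x, |f x| ≤ Kb) →
      ENNReal.ofReal (C * varPi π f) ≤ Estar π q f := by
  choose M hM using fun i => ev_ratio (πi i) (hπipos i) K α hα (hdecay i)
  choose g Cg hCg hg1 hg2 hg3 using fun i => exists_w (πi i) (hπipos i) (M i) (hM i)
  have hgpos : ∀ i n, 0 < g i n := fun i n => (hπipos i n).trans_le (hg1 i n)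
  have hπ1 : HasSum π 1 := by
    have := hasSum_pi d πi hπipos hπi1
    rwa [← funext hπprod] at this
  have hπ0 : ∀ x, 0 < π x := fun x => by
    rw [hπprod]; exact Finset.prod_pos (fun i _ => hπipos _ _)
  set w : (Fin d → ℕ) → ℝ := fun x => ∏ i, g i (x i) with hw
  set CP : ℝ := ∏ i, Cg i with hCP
  have hCP0 : 0 < CP := Finset.prod_pos (fun i _ => hCg i)
  have hw0 : ∀ x, 0 ≤ w x := fun x => Finset.prod_nonneg (fun i _ => (hgpos _ _).le)
  have hπw : ∀ x, π x ≤ w x := fun x => by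
    rw [hπprod]
    exact Finset.prod_le_prod (fun i _ => (hπipos _ _).le) (fun i _ => hg1 _ _)
  have hwπ : ∀ x, w x ≤ CP * π x := fun x => by
    rw [hπprod, hCP, ← Finset.prod_mul_distrib]
    exact Finset.prod_le_prod (fun i _ => (hgpos _ _).le) (fun i _ => hg2 _ _)
  have hws : Summable w :=
    Summable.of_nonneg_of_le hw0 hwπ (hπ1.summable.mul_left CP)
  have hdec : ∀ i x, w (x + eN i) ≤ w x / 4 := fun i x => by
    simp only [hw]
    rw [prod_shift, ← Finset.mul_prod_erase Finset.univ (fun l => g l (x l)) (Finset.mem_univ i)]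
    have h1 : 0 ≤ ∏ l ∈ Finset.univ.erase i, g l (x l) :=
      Finset.prod_nonneg (fun i _ => (hgpos _ _).le)
    have h2 := mul_le_mul_of_nonneg_right (hg3 i (x i)) h1
    linarith
  have hle : ∀ i x, w (x + eN i) ≤ w x := fun i x => by linarith [hdec i x, hw0 x]
  obtain ⟨j, hj⟩ := hJ0ne
  have hR : ∀ x, w x ≤ (g j (x j) / g j (x j + 1)) * w (x + eN j) := fun x => by
    simp only [hw]
    rw [prod_shift, ← Finset.mul_prod_erase Finset.univ (fun l => g l (x l)) (Finset.mem_univ j),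
      ← mul_assoc, div_mul_cancel₀ _ (hgpos j _).ne']
  let D : Fin d → ((Fin d → ℕ) → ℝ) → ℝ := fun i f =>
    ∑' x, (if i ∈ J 0 ∨ N ≤ x j then π x else 0) * (f (x + eN i) - f x) ^ 2
  have hu0 : ∀ i x, 0 ≤ (if i ∈ J 0 ∨ N ≤ x j then π x else 0) := fun i x => by
    split_ifs; exacts [(hπ0 x).le, le_rfl]
  have hD0 : ∀ i f, 0 ≤ D i f := fun i f =>
    tsum_nonneg (fun x => mul_nonneg (hu0 i x) (sq_nonneg _))
  have sD : ∀ i (f : (Fin d → ℕ) → ℝ) B, (∀ x, |f x| ≤ B) →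
      Summable (fun x => (if i ∈ J 0 ∨ N ≤ x j then π x else 0) * (f (x + eN i) - f x) ^ 2) :=
    fun i f B hf => summ hπ1.summable _ _ (hu0 i)
      (fun x => by split_ifs; exacts [le_rfl, (hπ0 x).le]) (4 * B ^ 2)
      (fun x => sq_nonneg _) (fun x => sqb hf _ _)
  -- comparison of uncatalysed sums
  have hJ0D : ∀ i ∈ J 0, ∀ (f : (Fin d → ℕ) → ℝ) B, (∀ x, |f x| ≤ B) →
      ∑' x, w x * (f (x + eN i) - f x) ^ 2 ≤ CP * D i f := fun i hi f B hf => by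
    simp only [D]
    rw [← tsum_mul_left]
    refine Summable.tsum_le_tsum (fun x => ?_) (summ hws w _ hw0 (fun _ => le_rfl) (4 * B ^ 2)
      (fun x => sq_nonneg _) (fun x => sqb hf _ _)) ((sD i f B hf).mul_left _)
    rw [if_pos (Or.inl hi), ← mul_assoc]
    exact mul_le_mul_of_nonneg_right (hwπ x) (sq_nonneg _)
  have hE : ∀ i, ∃ C : ℝ, 0 ≤ C ∧ ∀ (f : (Fin d → ℕ) → ℝ) B, (∀ x, |f x| ≤ B) →
      ∑' x, w (x + eN i) * (f (x + eN i) - f x) ^ 2 ≤ C * ∑ l, D l f := by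
    intro i
    have hDs : ∀ l f, D l f ≤ ∑ l, D l f := fun l f =>
      Finset.single_le_sum (f := fun l => D l f) (fun l _ => hD0 l f) (Finset.mem_univ l)
    by_cases hi : i ∈ J 0
    · refine ⟨CP, hCP0.le, fun f B hf => ?_⟩
      refine le_trans ?_ (mul_le_mul_of_nonneg_left (hDs i f) hCP0.le)
      refine le_trans ?_ (hJ0D i hi f B hf)
      refine Summable.tsum_le_tsum
        (fun x => mul_le_mul_of_nonneg_right (hle i x) (sq_nonneg _))
        (summ hws _ _ (fun x => hw0 _) (hle i) (4 * B ^ 2)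
          (fun x => sq_nonneg _) (fun x => sqb hf _ _))
        (summ hws w _ hw0 (fun _ => le_rfl) (4 * B ^ 2)
          (fun x => sq_nonneg _) (fun x => sqb hf _ _))
    · have hij : i ≠ j := fun h => hi (h ▸ hj)
      obtain ⟨C, hC, h⟩ := catal hws hw0 hdec i j hij (fun k => g j k / g j (k + 1))
        (fun k => div_nonneg (hgpos _ _).le (hgpos _ _).le) hR N
      refine ⟨C * (2 * CP), by positivity, fun f B hf => ?_⟩
      refine (h f B hf).trans ?_
      rw [mul_assoc]
      refine mul_le_mul_of_nonneg_left ?_ hC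
      have h1 := hJ0D j hj f B hf
      have h2 : ∑' x, (if N ≤ x j then w (x + eN i) else 0) * (f (x + eN i) - f x) ^ 2
          ≤ CP * D i f := by
        simp only [D]
        rw [← tsum_mul_left]
        refine Summable.tsum_le_tsum (fun x => ?_) (summ hws _ _
          (fun x => by split_ifs; exacts [hw0 _, le_rfl])
          (fun x => by split_ifs; exacts [hle i x, hw0 x]) (4 * B ^ 2)
          (fun x => sq_nonneg _) (fun x => sqb hf _ _)) ((sD i f B hf).mul_left _)
        rw [← mul_assoc]
        refine mul_le_mul_of_nonneg_right ?_ (sq_nonneg _)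
        by_cases hx : N ≤ x j
        · rw [if_pos hx, if_pos (Or.inr hx)]
          exact (hle i x).trans (hwπ x)
        · rw [if_neg hx]
          exact mul_nonneg hCP0.le (hu0 i x)
      have h3 := mul_le_mul_of_nonneg_left (hDs i f) hCP0.le
      have h4 := mul_le_mul_of_nonneg_left (hDs j f) hCP0.le
      linarith
  choose CE hCE0 hCE using hE
  obtain ⟨C1, hC1, hall⟩ := allcoord hws hw0 hdec Finset.univ
  have hq' : ∀ i x, (i ∈ J 0 ∨ N ≤ x j) → cmin ≤ q x (x + eN i) := by
    intro i x h
    by_cases hi : i ∈ J 0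
    · exact (hJ0 i hi).1 x
    · obtain ⟨k, hk⟩ := hcover i
      have hk0 : k ≠ 0 := fun h => hi (h ▸ hk)
      exact (hJl k hk0 i hk).1 x ⟨0, Fin.pos_of_ne_zero hk0, j, hj, h.resolve_left hi⟩
  have hDT : ∀ i (f : (Fin d → ℕ) → ℝ) B, (∀ x, |f x| ≤ B) → ENNReal.ofReal (cmin * D i f) ≤
      ∑' p : (Fin d → ℕ) × (Fin d → ℕ),
        ENNReal.ofReal ((f p.1 - f p.2) ^ 2 * π p.1 * q p.1 p.2) := by
    intro i f B hf
    simp only [D]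
    rw [← tsum_mul_left, ENNReal.ofReal_tsum_of_nonneg
      (fun x => mul_nonneg hcmin.le (mul_nonneg (hu0 i x) (sq_nonneg _)))
      ((sD i f B hf).mul_left _)]
    have hinj : Function.Injective (fun x : Fin d → ℕ => (x, x + eN i)) :=
      fun x y h => (Prod.ext_iff.1 h).1
    refine le_trans ?_ (ENNReal.tsum_comp_le_tsum_of_injective hinj _)
    refine ENNReal.tsum_le_tsum (fun x => ?_)
    by_cases hx : i ∈ J 0 ∨ N ≤ x j
    · rw [if_pos hx]
      refine ENNReal.ofReal_le_ofReal ?_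
      have := mul_le_mul_of_nonneg_left (hq' i x hx)
        (mul_nonneg (sq_nonneg (f x - f (x + eN i))) (hπ0 x).le)
      have e : cmin * (π x * (f (x + eN i) - f x) ^ 2) = (f x - f (x + eN i)) ^ 2 * π x * cmin := by
        ring
      rw [e]
      exact this
    · rw [if_neg hx]
      simp
  set A : ℝ := C1 * (∑ i, CE i) * d / cmin with hA
  have hA0 : 0 ≤ A :=
    div_nonneg (mul_nonneg (mul_nonneg hC1 (Finset.sum_nonneg (fun i _ => hCE0 i)))
      (Nat.cast_nonneg d)) hcmin.le
  refine ⟨1 / (2 * (A + 1)), by positivity, ?_⟩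
  rintro f ⟨B, hf⟩
  set T := ∑' p : (Fin d → ℕ) × (Fin d → ℕ),
        ENNReal.ofReal ((f p.1 - f p.2) ^ 2 * π p.1 * q p.1 p.2) with hT
  have hTE : Estar π q f = T / 2 := rfl
  rw [hTE]
  by_cases hTtop : T = ⊤
  · rw [hTtop, ENNReal.top_div_of_ne_top (by norm_num)]
    exact le_top
  have hDr : ∀ i, D i f ≤ T.toReal / cmin := fun i => by
    rw [le_div_iff₀ hcmin, mul_comm]
    exact (ENNReal.ofReal_le_iff_le_toReal hTtop).1 (hDT i f B hf)
  have hTr0 : 0 ≤ T.toReal := ENNReal.toReal_nonneg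
  have hvar : varPi π f ≤ A * T.toReal := by
    have v1 := var_le_s2 π f (fun x => (hπ0 x).le) hπ1 B hf (f 0)
    have hT0 : ∀ x : Fin d → ℕ, Ts Finset.univ x = 0 := fun x => by funext l; simp [Ts]
    have v2 : ∑' x, π x * (f x - f 0) ^ 2 ≤ ∑' x, w x * (f x - f 0) ^ 2 :=
      Summable.tsum_le_tsum (fun x => mul_le_mul_of_nonneg_right (hπw x) (sq_nonneg _))
        (summ hws _ _ (fun x => (hπ0 x).le) hπw (4 * B ^ 2)
          (fun x => sq_nonneg _) (fun x => sqb hf _ _))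
        (summ hws w _ hw0 (fun _ => le_rfl) (4 * B ^ 2)
          (fun x => sq_nonneg _) (fun x => sqb hf _ _))
    have v3 := hall f B hf
    simp only [hT0] at v3
    have v4 : ∑ l, D l f ≤ d * (T.toReal / cmin) := by
      refine (Finset.sum_le_sum (fun l _ => hDr l)).trans ?_
      simp
    have v5 : ∑ i, ∑' x, w (x + eN i) * (f (x + eN i) - f x) ^ 2 ≤
        (∑ i, CE i) * (d * (T.toReal / cmin)) := by
      rw [Finset.sum_mul]
      exact Finset.sum_le_sum (fun i _ => (hCE i f B hf).trans
        (mul_le_mul_of_nonneg_left v4 (hCE0 i)))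
    have v6 := mul_le_mul_of_nonneg_left v5 hC1
    have e : A * T.toReal = C1 * ((∑ i, CE i) * (d * (T.toReal / cmin))) := by
      rw [hA]; ring
    rw [e]
    linarith
  have e2 : T / 2 = ENNReal.ofReal (T.toReal / 2) := by
    rw [ENNReal.ofReal_div_of_pos (by norm_num), ENNReal.ofReal_toReal hTtop]
    simp
  rw [e2]
  refine ENNReal.ofReal_le_ofReal ?_
  rw [div_mul_eq_mul_div, one_mul, div_le_iff₀ (by positivity)]
  linarith
end

section
/- Example 2.12, positive gap part. Consider the Markov chain on ℤ²_{≥0} with rates q(x, x+e₁) = κ₁x₂, q(x, x−e₁) = κ₂x₁x₂, q(x, x+e₂) = κ₃, q(x, x−e₂) = κ₄x₂ (all other transitions rate 0), where κ₁,κ₂,κ₃,κ₄ > 0, and let π(x) = e^{−κ₁/κ₂−κ₃/κ₄} (κ₁/κ₂)^{x₁}/x₁! · (κ₃/κ₄)^{x₂}/x₂!. Then there exists C > 0 such that for every bounded f : ℤ²_{≥0} → ℝ one has E*(f) ≥ C · Var_π(f), where E*(f) = (1/2) Σ_{x,z} (f(x)−f(z))² π(x) q(x,z). -/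
open scoped ENNReal

/-- Transition rates of Example 2.12:
`q(x, x+e₁) = κ₁x₂`, `q(x, x−e₁) = κ₂x₁x₂`, `q(x, x+e₂) = κ₃`, `q(x, x−e₂) = κ₄x₂`. -/
noncomputable def qEx (κ1 κ2 κ3 κ4 : ℝ) (x z : ℕ × ℕ) : ℝ :=
  if z = (x.1 + 1, x.2) then κ1 * x.2
  else if x = (z.1 + 1, z.2) then κ2 * x.1 * x.2
  else if z = (x.1, x.2 + 1) then κ3
  else if x = (z.1, z.2 + 1) then κ4 * x.2
  else 0

/-- Product-form Poisson stationary distribution of Example 2.12. -/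
noncomputable def piEx (κ1 κ2 κ3 κ4 : ℝ) (x : ℕ × ℕ) : ℝ :=
  Real.exp (-(κ1 / κ2) - κ3 / κ4) * ((κ1 / κ2) ^ x.1 / (x.1.factorial : ℝ)) *
    ((κ3 / κ4) ^ x.2 / (x.2.factorial : ℝ))

/-- Unnormalised Poisson weight. -/
noncomputable def PW (a : ℝ) (n : ℕ) : ℝ≥0∞ := ENNReal.ofReal (a ^ n / (n.factorial : ℝ))

lemma PW_tsum {a : ℝ} (ha : 0 < a) : ∑' n, PW a n = ENNReal.ofReal (Real.exp a) := by
  unfold PW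
  rw [← ENNReal.ofReal_tsum_of_nonneg (fun n => by positivity) (Real.summable_pow_div_factorial a)]
  rw [Real.exp_eq_exp_ℝ, NormedSpace.exp_eq_tsum_div]

lemma PW_succ {a : ℝ} (ha : 0 < a) (m : ℕ) :
    ((m + 1 : ℕ) : ℝ≥0∞) * PW a (m + 1) = ENNReal.ofReal a * PW a m := by
  unfold PW
  rw [← ENNReal.ofReal_natCast, ← ENNReal.ofReal_mul (by positivity),
    ← ENNReal.ofReal_mul (by positivity)]
  congr 1
  rw [Nat.factorial_succ]
  push_cast
  field_simp
  ring

lemma PW_add {a : ℝ} (ha : 0 < a) (k j : ℕ) : PW a (k + j) ≤ PW a k * PW a j := by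
  unfold PW
  rw [← ENNReal.ofReal_mul (by positivity)]
  apply ENNReal.ofReal_le_ofReal
  rw [div_mul_div_comm, ← pow_add]
  apply div_le_div_of_nonneg_left (by positivity) (by positivity)
  exact_mod_cast Nat.le_of_dvd (Nat.factorial_pos _) (Nat.factorial_mul_factorial_dvd_factorial_add k j)

lemma PW_tail {a : ℝ} (ha : 0 < a) (k : ℕ) :
    ∑' n, (if k < n then (n : ℝ≥0∞) * PW a n else 0)
      ≤ ENNReal.ofReal (a * Real.exp a) * PW a k := by
  have hinj : Function.Injective (fun j : ℕ => k + j + 1) := fun i j h => by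
    simp only at h; omega
  have := hinj.tsum_eq (f := fun n => (if k < n then (n : ℝ≥0∞) * PW a n else 0)) (by
    intro n hn
    have : k < n := by
      by_contra h
      simp [h] at hn
    exact ⟨n - k - 1, by simp only; omega⟩)
  rw [← this]
  calc ∑' j : ℕ, (if k < k + j + 1 then ((k + j + 1 : ℕ) : ℝ≥0∞) * PW a (k + j + 1) else 0)
      ≤ ∑' j : ℕ, ENNReal.ofReal a * PW a k * PW a j := by
        apply ENNReal.tsum_le_tsum
        intro j
        rw [if_pos (by omega), PW_succ ha, mul_assoc]
        gcongr
        exact PW_add ha k j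
    _ = _ := by
        rw [ENNReal.tsum_mul_left, PW_tsum ha, ENNReal.ofReal_mul ha.le]
        ring

lemma hardy_s14 {a : ℝ} (ha : 0 < a) (h : ℕ → ℝ) :
    ∑' n, ENNReal.ofReal ((h n - h 0) ^ 2) * PW a n
      ≤ ENNReal.ofReal (a * Real.exp a) * ∑' n, ENNReal.ofReal ((h (n + 1) - h n) ^ 2) * PW a n := by
  calc ∑' n, ENNReal.ofReal ((h n - h 0) ^ 2) * PW a n
      ≤ ∑' n, ∑' k, ENNReal.ofReal ((h (k + 1) - h k) ^ 2) *
          (if k < n then (n : ℝ≥0∞) * PW a n else 0) := by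
        apply ENNReal.tsum_le_tsum
        intro n
        have h1 : (h n - h 0) ^ 2 ≤ n * ∑ k ∈ Finset.range n, (h (k + 1) - h k) ^ 2 := by
          rw [← Finset.sum_range_sub]
          simpa using sq_sum_le_card_mul_sum_sq (s := Finset.range n)
            (f := fun k => h (k + 1) - h k)
        rw [tsum_eq_sum (s := Finset.range n) (by
          intro k hk
          simp at hk
          simp [hk])]
        calc ENNReal.ofReal ((h n - h 0) ^ 2) * PW a n
            ≤ ENNReal.ofReal (n * ∑ k ∈ Finset.range n, (h (k + 1) - h k) ^ 2) * PW a n := by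
              gcongr
          _ = ∑ k ∈ Finset.range n, ENNReal.ofReal ((h (k + 1) - h k) ^ 2) *
                ((n : ℝ≥0∞) * PW a n) := by
              rw [ENNReal.ofReal_mul (by positivity),
                ENNReal.ofReal_sum_of_nonneg (fun _ _ => sq_nonneg _), ← Finset.sum_mul,
                ENNReal.ofReal_natCast]
              ring
          _ ≤ _ := by
              apply Finset.sum_le_sum
              intro k hk
              rw [if_pos (Finset.mem_range.1 hk)]
    _ = ∑' k, ENNReal.ofReal ((h (k + 1) - h k) ^ 2) *
          ∑' n, (if k < n then (n : ℝ≥0∞) * PW a n else 0) := by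
        rw [ENNReal.tsum_comm]
        simp_rw [ENNReal.tsum_mul_left]
    _ ≤ ∑' k, ENNReal.ofReal ((h (k + 1) - h k) ^ 2) *
          (ENNReal.ofReal (a * Real.exp a) * PW a k) := by
        gcongr with k
        exact PW_tail ha k
    _ = _ := by
        rw [← ENNReal.tsum_mul_left]
        congr 1; ext k; ring

lemma piEx_nonneg {κ1 κ2 κ3 κ4 : ℝ}
    (h1 : 0 < κ1) (h2 : 0 < κ2) (h3 : 0 < κ3) (h4 : 0 < κ4) (x : ℕ × ℕ) :
    0 ≤ piEx κ1 κ2 κ3 κ4 x := by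
  unfold piEx; positivity

lemma piEx_hasSum {κ1 κ2 κ3 κ4 : ℝ}
    (h1 : 0 < κ1) (h2 : 0 < κ2) (h3 : 0 < κ3) (h4 : 0 < κ4) :
    HasSum (piEx κ1 κ2 κ3 κ4) 1 := by
  have key : ∀ a : ℝ, HasSum (fun n : ℕ => a ^ n / (n.factorial : ℝ)) (Real.exp a) := fun a => by
    rw [Real.exp_eq_exp_ℝ]
    exact NormedSpace.expSeries_div_hasSum_exp a
  have ha : 0 < κ1 / κ2 := by positivity
  have hb : 0 < κ3 / κ4 := by positivity
  have := ((key (κ1 / κ2)).mul (key (κ3 / κ4))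
    ((key (κ1 / κ2)).summable.mul_of_nonneg (key (κ3 / κ4)).summable
      (fun n => by positivity) (fun n => by positivity))).mul_left
      (Real.exp (-(κ1 / κ2) - κ3 / κ4))
  rw [← Real.exp_add, ← Real.exp_add] at this
  have e1 : piEx κ1 κ2 κ3 κ4 = fun i : ℕ × ℕ => Real.exp (-(κ1 / κ2) - κ3 / κ4) *
      ((κ1 / κ2) ^ i.1 / (i.1.factorial : ℝ) * ((κ3 / κ4) ^ i.2 / (i.2.factorial : ℝ))) := by
    funext x
    unfold piEx
    ring
  have e2 : Real.exp (-(κ1 / κ2) - κ3 / κ4 + (κ1 / κ2 + κ3 / κ4)) = 1 := by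
    rw [show -(κ1 / κ2) - κ3 / κ4 + (κ1 / κ2 + κ3 / κ4) = 0 by ring, Real.exp_zero]
  rw [e1, ← e2]
  exact this

lemma var_le_s14 {α : Type*} (π : α → ℝ) (hπ : ∀ x, 0 ≤ π x) (hs : HasSum π 1) (f : α → ℝ)
    (K : ℝ) (hK : ∀ x, |f x| ≤ K) (c : ℝ) :
    ENNReal.ofReal (varPi π f) ≤ ∑' x, ENNReal.ofReal ((f x - c) ^ 2) * ENNReal.ofReal (π x) := by
  have s1 : Summable (fun x => f x * π x) := by
    apply Summable.of_norm_bounded (hs.summable.mul_left K)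
    intro x
    rw [norm_mul, Real.norm_eq_abs, Real.norm_eq_abs, abs_of_nonneg (hπ x)]
    exact mul_le_mul_of_nonneg_right (hK x) (hπ x)
  have s2 : Summable (fun x => f x ^ 2 * π x) := by
    apply Summable.of_norm_bounded (hs.summable.mul_left (K ^ 2))
    intro x
    rw [norm_mul, Real.norm_eq_abs, Real.norm_eq_abs, abs_of_nonneg (hπ x), abs_pow]
    exact mul_le_mul_of_nonneg_right (pow_le_pow_left₀ (abs_nonneg _) (hK x) 2) (hπ x)
  have s3 : HasSum (fun x => (f x - c) ^ 2 * π x)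
      ((∑' x, f x ^ 2 * π x) - 2 * c * (∑' x, f x * π x) + c ^ 2 * 1) := by
    have h := (s2.hasSum.sub (s1.hasSum.mul_left (2 * c))).add (hs.mul_left (c ^ 2))
    have e1 : (fun x => (f x - c) ^ 2 * π x) =
        fun x => f x ^ 2 * π x - 2 * c * (f x * π x) + c ^ 2 * π x := by
      funext x; ring
    rw [e1]
    exact h
  simp_rw [← ENNReal.ofReal_mul (sq_nonneg (_ : ℝ))]
  rw [← ENNReal.ofReal_tsum_of_nonneg (fun x => mul_nonneg (sq_nonneg _) (hπ x)) s3.summable,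
    s3.tsum_eq]
  apply ENNReal.ofReal_le_ofReal
  unfold varPi
  nlinarith [sq_nonneg ((∑' x, f x * π x) - c)]

lemma piEx_PW {κ1 κ2 κ3 κ4 : ℝ}
    (h1 : 0 < κ1) (h2 : 0 < κ2) (h3 : 0 < κ3) (h4 : 0 < κ4) (x : ℕ × ℕ) :
    ENNReal.ofReal (piEx κ1 κ2 κ3 κ4 x) =
      ENNReal.ofReal (Real.exp (-(κ1 / κ2) - κ3 / κ4)) * PW (κ1 / κ2) x.1 * PW (κ3 / κ4) x.2 := by
  unfold piEx PW
  rw [ENNReal.ofReal_mul (by positivity), ENNReal.ofReal_mul (by positivity)]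

/-- Combination of the two Hardy inequalities along a degenerate product chain. -/
lemma comb {a b : ℝ} (ha : 0 < a) (hb : 0 < b) (e : ℝ≥0∞) (f : ℕ × ℕ → ℝ) :
    ∑' x : ℕ × ℕ, ENNReal.ofReal ((f x - f (0, 1)) ^ 2) * (e * PW a x.1 * PW b x.2) ≤
      3 * (ENNReal.ofReal (b * Real.exp b + Real.exp b) *
          (∑' x : ℕ × ℕ, ENNReal.ofReal ((f (x.1, x.2 + 1) - f x) ^ 2) * (e * PW a x.1 * PW b x.2)) +
        ENNReal.ofReal (Real.exp b * (a * Real.exp a) / b) *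
          (∑' x : ℕ × ℕ, x.2 * (ENNReal.ofReal ((f (x.1 + 1, x.2) - f x) ^ 2) *
            (e * PW a x.1 * PW b x.2)))) := by
  set B := ∑' x : ℕ × ℕ, ENNReal.ofReal ((f (x.1, x.2 + 1) - f x) ^ 2) *
    (e * PW a x.1 * PW b x.2) with hB
  set A := ∑' x : ℕ × ℕ, (x.2 : ℝ≥0∞) * (ENNReal.ofReal ((f (x.1 + 1, x.2) - f x) ^ 2) *
            (e * PW a x.1 * PW b x.2)) with hA
  have T1 : ∑' x : ℕ × ℕ, ENNReal.ofReal ((f x - f (x.1, 0)) ^ 2) * (e * PW a x.1 * PW b x.2)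
      ≤ ENNReal.ofReal (b * Real.exp b) * B := by
    rw [hB, ENNReal.tsum_prod', ENNReal.tsum_prod', ← ENNReal.tsum_mul_left]
    apply ENNReal.tsum_le_tsum
    intro m
    have := hardy_s14 hb (fun n => f (m, n))
    calc _ = e * PW a m * ∑' n, ENNReal.ofReal ((f (m, n) - f (m, 0)) ^ 2) * PW b n := by
          rw [← ENNReal.tsum_mul_left]; congr 1; ext n; ring
      _ ≤ e * PW a m * _ := mul_le_mul_right this _
      _ = _ := by
          rw [mul_left_comm, ← ENNReal.tsum_mul_left]; congr 2; ext n; ring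
  have T2 : ∑' x : ℕ × ℕ, ENNReal.ofReal ((f (x.1, 1) - f (x.1, 0)) ^ 2) *
      (e * PW a x.1 * PW b x.2) ≤ ENNReal.ofReal (Real.exp b) * B := by
    rw [hB, ENNReal.tsum_prod', ENNReal.tsum_prod', ← ENNReal.tsum_mul_left]
    apply ENNReal.tsum_le_tsum
    intro m
    calc _ = ENNReal.ofReal (Real.exp b) *
            (ENNReal.ofReal ((f (m, 0 + 1) - f (m, 0)) ^ 2) * (e * PW a m * PW b 0)) := by
          rw [← PW_tsum hb, ← ENNReal.tsum_mul_right]; congr 1; ext n; simp [PW]; ring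
      _ ≤ _ := by
          gcongr
          exact ENNReal.le_tsum (f := fun n => ENNReal.ofReal ((f (m, n + 1) - f (m, n)) ^ 2) *
            (e * PW a m * PW b n)) 0
  have T3 : ∑' x : ℕ × ℕ, ENNReal.ofReal ((f (x.1, 1) - f (0, 1)) ^ 2) *
      (e * PW a x.1 * PW b x.2) ≤ ENNReal.ofReal (Real.exp b * (a * Real.exp a) / b) * A := by
    have hb1 : PW b 1 = ENNReal.ofReal b := by simp [PW]
    have hc : ENNReal.ofReal (Real.exp b * (a * Real.exp a) / b) * ENNReal.ofReal b
        = ENNReal.ofReal (Real.exp b) * ENNReal.ofReal (a * Real.exp a) := by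
      rw [← ENNReal.ofReal_mul (by positivity), ← ENNReal.ofReal_mul (by positivity)]
      congr 1; field_simp
    have hA' : e * ENNReal.ofReal b *
        ∑' m, ENNReal.ofReal ((f (m + 1, 1) - f (m, 1)) ^ 2) * PW a m ≤ A := by
      rw [hA, ENNReal.tsum_prod', ← ENNReal.tsum_mul_left]
      apply ENNReal.tsum_le_tsum
      intro m
      refine le_trans (le_of_eq ?_) (ENNReal.le_tsum 1)
      simp [hb1]; ring
    calc _ = e * ENNReal.ofReal (Real.exp b) *
          ∑' m, ENNReal.ofReal ((f (m, 1) - f (0, 1)) ^ 2) * PW a m := by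
          rw [ENNReal.tsum_prod', ← ENNReal.tsum_mul_left]
          congr 1; ext m
          rw [← PW_tsum hb, mul_assoc, mul_comm (∑' n, PW b n), ← mul_assoc,
            ← ENNReal.tsum_mul_left]
          refine tsum_congr fun n => ?_
          ring
      _ ≤ e * ENNReal.ofReal (Real.exp b) * _ :=
          mul_le_mul_right (hardy_s14 ha (fun m => f (m, 1))) _
      _ = ENNReal.ofReal (Real.exp b * (a * Real.exp a) / b) * (e * ENNReal.ofReal b *
        ∑' m, ENNReal.ofReal ((f (m + 1, 1) - f (m, 1)) ^ 2) * PW a m) := by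
          rw [mul_comm e (ENNReal.ofReal b), mul_assoc (ENNReal.ofReal b), ← mul_assoc _ (ENNReal.ofReal b), hc]
          ring
      _ ≤ _ := by gcongr
  rw [ENNReal.ofReal_add (by positivity) (by positivity), add_mul]
  refine le_trans ?_ (mul_le_mul_right (add_le_add (add_le_add T1 T2) T3) 3)
  rw [← ENNReal.tsum_add, ← ENNReal.tsum_add, ← ENNReal.tsum_mul_left]
  apply ENNReal.tsum_le_tsum
  intro x
  rw [← add_mul, ← add_mul, ← mul_assoc 3, ← ENNReal.ofReal_add (by positivity) (by positivity),
    ← ENNReal.ofReal_add (by positivity) (by positivity)]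
  refine mul_le_mul_left ?_ _
  rw [show (3 : ℝ≥0∞) = ENNReal.ofReal 3 by simp, ← ENNReal.ofReal_mul (by norm_num)]
  apply ENNReal.ofReal_le_ofReal
  nlinarith [sq_nonneg ((f x - f (x.1, 0)) + (f (x.1, 1) - f (x.1, 0))),
    sq_nonneg ((f x - f (x.1, 0)) - (f (x.1, 1) - f (0, 1))),
    sq_nonneg ((f (x.1, 1) - f (x.1, 0)) + (f (x.1, 1) - f (0, 1)))]

/-- Example 2.12, positive gap part. -/
theorem example_2_12_gap (κ1 κ2 κ3 κ4 : ℝ)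
    (h1 : 0 < κ1) (h2 : 0 < κ2) (h3 : 0 < κ3) (h4 : 0 < κ4) :
    ∃ C > 0, ∀ f : ℕ × ℕ → ℝ, (∃ Kb, ∀ x, |f x| ≤ Kb) →
      ENNReal.ofReal (C * varPi (piEx κ1 κ2 κ3 κ4) f)
        ≤ Estar (piEx κ1 κ2 κ3 κ4) (qEx κ1 κ2 κ3 κ4) f := by
  have ha : 0 < κ1 / κ2 := by positivity
  have hb : 0 < κ3 / κ4 := by positivity
  set a := κ1 / κ2 with hadef
  set b := κ3 / κ4 with hbdef
  set c1 := b * Real.exp b + Real.exp b with hc1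
  set c2 := Real.exp b * (a * Real.exp a) / b with hc2
  have p1 : 0 < c1 := by positivity
  have p2 : 0 < c2 := by positivity
  refine ⟨(3 * (c1 / κ3 + c2 / κ1) * 2)⁻¹, by positivity, ?_⟩
  rintro f ⟨K, hK⟩
  have hv := var_le_s14 _ (piEx_nonneg h1 h2 h3 h4) (piEx_hasSum h1 h2 h3 h4) f K hK (f (0, 1))
  have hw : ∀ x, ENNReal.ofReal (piEx κ1 κ2 κ3 κ4 x) =
      ENNReal.ofReal (Real.exp (-a - b)) * PW a x.1 * PW b x.2 := piEx_PW h1 h2 h3 h4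
  simp_rw [hw] at hv
  have hv2 := hv.trans (comb ha hb _ f)
  simp_rw [← hw] at hv2
  set S := ∑' p : (ℕ × ℕ) × (ℕ × ℕ), ENNReal.ofReal ((f p.1 - f p.2) ^ 2 *
    piEx κ1 κ2 κ3 κ4 p.1 * qEx κ1 κ2 κ3 κ4 p.1 p.2) with hS
  have hB : ENNReal.ofReal κ3 * ∑' x : ℕ × ℕ, ENNReal.ofReal ((f (x.1, x.2 + 1) - f x) ^ 2) *
      ENNReal.ofReal (piEx κ1 κ2 κ3 κ4 x) ≤ S := by
    rw [← ENNReal.tsum_mul_left]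
    have hinj : Function.Injective (fun x : ℕ × ℕ => (x, (x.1, x.2 + 1))) :=
      fun x y h => (Prod.mk.inj h).1
    refine le_trans (le_of_eq ?_) (ENNReal.tsum_comp_le_tsum_of_injective hinj _)
    congr 1; ext x
    have := piEx_nonneg h1 h2 h3 h4 x
    rw [← ENNReal.ofReal_mul (sq_nonneg _), ← ENNReal.ofReal_mul h3.le]
    congr 1
    have : qEx κ1 κ2 κ3 κ4 x (x.1, x.2 + 1) = κ3 := by
      obtain ⟨m, n⟩ := x
      simp [qEx]
    simp only [this]
    ring
  have hA : ENNReal.ofReal κ1 * ∑' x : ℕ × ℕ, (x.2 : ℝ≥0∞) *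
      (ENNReal.ofReal ((f (x.1 + 1, x.2) - f x) ^ 2) *
      ENNReal.ofReal (piEx κ1 κ2 κ3 κ4 x)) ≤ S := by
    rw [← ENNReal.tsum_mul_left]
    have hinj : Function.Injective (fun x : ℕ × ℕ => (x, (x.1 + 1, x.2))) :=
      fun x y h => (Prod.mk.inj h).1
    refine le_trans (le_of_eq ?_) (ENNReal.tsum_comp_le_tsum_of_injective hinj _)
    congr 1; ext x
    have := piEx_nonneg h1 h2 h3 h4 x
    rw [← ENNReal.ofReal_mul (sq_nonneg _), ← ENNReal.ofReal_natCast,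
      ← ENNReal.ofReal_mul (by positivity), ← ENNReal.ofReal_mul h1.le]
    congr 1
    have : qEx κ1 κ2 κ3 κ4 x (x.1 + 1, x.2) = κ1 * x.2 := by
      simp [qEx]
    simp only [this]
    ring
  have split : ∀ c κ : ℝ, 0 < c → 0 < κ → ENNReal.ofReal c =
      ENNReal.ofReal (c / κ) * ENNReal.ofReal κ := fun c κ hc hκ => by
    rw [← ENNReal.ofReal_mul (by positivity)]; congr 1; field_simp
  rw [split c1 κ3 p1 h3, split c2 κ1 p2 h1, mul_assoc, mul_assoc] at hv2
  have hv3 : ENNReal.ofReal (varPi (piEx κ1 κ2 κ3 κ4) f) ≤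
      ENNReal.ofReal (3 * (c1 / κ3 + c2 / κ1)) * S := by
    refine hv2.trans ?_
    rw [ENNReal.ofReal_mul (by norm_num), ENNReal.ofReal_add (by positivity) (by positivity),
      mul_assoc, add_mul]
    simp only [ENNReal.ofReal_ofNat]
    gcongr
  unfold Estar
  rw [← hS, ENNReal.ofReal_mul (by positivity)]
  refine (mul_le_mul_right hv3 _).trans (le_of_eq ?_)
  rw [← mul_assoc, ← ENNReal.ofReal_mul (by positivity), ENNReal.div_eq_inv_mul]
  congr 1
  rw [show (2 : ℝ≥0∞) = ENNReal.ofReal 2 by simp, ← ENNReal.ofReal_inv_of_pos (by norm_num)]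
  congr 1
  field_simp
end

section
/- Example 2.12, failure of the canonical path method. Consider the Markov chain on ℤ²_{≥0} with rates q(x, x+e₁) = κ₁x₂, q(x, x−e₁) = κ₂x₁x₂, q(x, x+e₂) = κ₃, q(x, x−e₂) = κ₄x₂ (all other transitions rate 0), where κ₁,κ₂,κ₃,κ₄ > 0, and let π(x) = e^{−κ₁/κ₂−κ₃/κ₄} (κ₁/κ₂)^{x₁}/x₁! · (κ₃/κ₄)^{x₂}/x₂!. Then for EVERY family Γ that assigns to each pair of distinct states x ≠ x' in ℤ²_{≥0} exactly one active directed path between them (either from x to x' or from x' to x, but not both), the congestion ratio C_cr(Γ) := sup over directed edges (z,w) with q(z,w) > 0 of (1/(q(z,w)π(z))) · Σ_{(x,x') : (z,w) is an edge of the path of Γ joining x and x'} |γ(x,x')| π(x)π(x') is infinite. -/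
open scoped ENNReal

theorem aux_q_le {κ1 κ2 κ3 κ4 : ℝ} {x z : ℕ × ℕ} (h : 0 < qEx κ1 κ2 κ3 κ4 x z) :
    x.1 ≤ z.1 + 1 ∧ z.1 ≤ x.1 + 1 := by
  obtain ⟨a, b⟩ := x
  obtain ⟨c, d⟩ := z
  unfold qEx at h
  simp only [Prod.mk.injEq] at h
  split_ifs at h <;> first | (exact absurd h (lt_irrefl _)) | (constructor <;> simp only <;> omega)

theorem aux_q_out {κ1 κ2 κ3 κ4 : ℝ} {m : ℕ} {z : ℕ × ℕ} (h : 0 < qEx κ1 κ2 κ3 κ4 (m, 0) z) :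
    z = (m, 1) := by
  obtain ⟨c, d⟩ := z
  unfold qEx at h
  simp only [Prod.mk.injEq] at h ⊢
  split_ifs at h <;> first | (simp at h) | omega

theorem aux_q_in {κ1 κ2 κ3 κ4 : ℝ} {m : ℕ} {z : ℕ × ℕ} (h : 0 < qEx κ1 κ2 κ3 κ4 z (m, 0)) :
    z = (m, 1) := by
  obtain ⟨c, d⟩ := z
  unfold qEx at h
  simp only [Prod.mk.injEq] at h ⊢
  rcases Nat.eq_zero_or_pos d with rfl | hd
  · simp at h
  · split_ifs at h <;> first | (exact absurd h (lt_irrefl _)) | omega | tauto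

theorem aux_len {κ1 κ2 κ3 κ4 : ℝ} (p : List (ℕ × ℕ)) : ∀ a b : ℕ × ℕ,
    p.head? = some a → p.getLast? = some b → ActivePath (qEx κ1 κ2 κ3 κ4) p →
    a.1 ≤ b.1 + p.length ∧ b.1 ≤ a.1 + p.length := by
  induction p with
  | nil => intro a b h; simp at h
  | cons x t ih =>
    intro a b ha hb hp
    cases t with
    | nil =>
      simp at ha hb
      subst ha hb
      simp
    | cons y t =>
      have h1 := ih y b (by simp) (by simpa using hb)
        (fun e he => hp e (by simp [edges] at he ⊢; exact Or.inr he))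
      have h2 := aux_q_le (hp (x, y) (by simp [edges]))
      simp only [List.head?_cons, Option.some.injEq] at ha
      subst ha
      simp only [List.length_cons] at h1 h2 ⊢
      omega

theorem aux_first {p : List (ℕ × ℕ)} {a b : ℕ × ℕ} (hab : a ≠ b)
    (ha : p.head? = some a) (hb : p.getLast? = some b) : ∃ y, (a, y) ∈ edges p := by
  match p with
  | [] => simp at ha
  | [x] => simp at ha hb; exact absurd (ha.symm.trans hb) hab
  | x :: y :: t =>
    simp only [List.head?_cons, Option.some.injEq] at ha
    subst ha
    exact ⟨y, by simp [edges]⟩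

theorem aux_last' (t : List (ℕ × ℕ)) : ∀ (x y b : ℕ × ℕ),
    (x :: y :: t).getLast? = some b → ∃ z, (z, b) ∈ edges (x :: y :: t) := by
  induction t with
  | nil => intro x y b hb; simp at hb; subst hb; exact ⟨x, by simp [edges]⟩
  | cons w t ih =>
    intro x y b hb
    obtain ⟨z, hz⟩ := ih y w b (by simpa using hb)
    exact ⟨z, by simp [edges] at hz ⊢; exact Or.inr hz⟩

theorem aux_last {p : List (ℕ × ℕ)} {a b : ℕ × ℕ} (hab : a ≠ b)
    (ha : p.head? = some a) (hb : p.getLast? = some b) : ∃ y, (y, b) ∈ edges p := by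
  match p with
  | [] => simp at ha
  | [x] => simp at ha hb; exact absurd (ha.symm.trans hb) hab
  | x :: y :: t => exact aux_last' t x y b hb

theorem aux_pi_pos {κ1 κ2 κ3 κ4 : ℝ} (h1 : 0 < κ1) (h2 : 0 < κ2) (h3 : 0 < κ3) (h4 : 0 < κ4)
    (x : ℕ × ℕ) : 0 < piEx κ1 κ2 κ3 κ4 x := by
  unfold piEx
  positivity

theorem aux_balance {κ1 κ2 κ3 κ4 : ℝ} (h4 : 0 < κ4) (m : ℕ) :
    κ4 * piEx κ1 κ2 κ3 κ4 (m, 1) = κ3 * piEx κ1 κ2 κ3 κ4 (m, 0) := by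
  unfold piEx
  simp
  field_simp

theorem aux_q_up (κ1 κ2 κ3 κ4 : ℝ) (m : ℕ) : qEx κ1 κ2 κ3 κ4 (m, 0) (m, 1) = κ3 := by
  simp [qEx]

theorem aux_q_down (κ1 κ2 κ3 κ4 : ℝ) (m : ℕ) : qEx κ1 κ2 κ3 κ4 (m, 1) (m, 0) = κ4 := by
  simp [qEx]

/-- Example 2.12: for every choice of paths, the congestion ratio of the canonical
path method is infinite. -/
theorem example_2_12_congestion_infinite (κ1 κ2 κ3 κ4 : ℝ)
    (h1 : 0 < κ1) (h2 : 0 < κ2) (h3 : 0 < κ3) (h4 : 0 < κ4)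
    (chosen : ℕ × ℕ → ℕ × ℕ → Bool)
    (g : ℕ × ℕ → ℕ × ℕ → List (ℕ × ℕ))
    (hchosen : ∀ x x' : ℕ × ℕ, x ≠ x' →
      Xor' (chosen x x' = true) (chosen x' x = true))
    (hg : ∀ x x' : ℕ × ℕ, x ≠ x' → chosen x x' = true →
      IsPathFromTo (g x x') x x' ∧ ActivePath (qEx κ1 κ2 κ3 κ4) (g x x')) :
    (⨆ (e : (ℕ × ℕ) × (ℕ × ℕ)) (_ : 0 < qEx κ1 κ2 κ3 κ4 e.1 e.2),
      (∑' p : (ℕ × ℕ) × (ℕ × ℕ),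
          if p.1 ≠ p.2 ∧ chosen p.1 p.2 = true ∧ e ∈ edges (g p.1 p.2) then
            ENNReal.ofReal (((g p.1 p.2).length : ℝ) *
              (piEx κ1 κ2 κ3 κ4 p.1 * piEx κ1 κ2 κ3 κ4 p.2))
          else 0)
        / ENNReal.ofReal (qEx κ1 κ2 κ3 κ4 e.1 e.2 * piEx κ1 κ2 κ3 κ4 e.1)) = ⊤ := by
  have pos := aux_pi_pos h1 h2 h3 h4
  have hc : 0 < piEx κ1 κ2 κ3 κ4 (0, 0) / κ3 := div_pos (pos _) h3
  -- one term of one edge sum gives a lower bound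
  have key : ∀ (e : (ℕ × ℕ) × (ℕ × ℕ)) (p : (ℕ × ℕ) × (ℕ × ℕ)) (m : ℕ),
      p.1 ≠ p.2 → chosen p.1 p.2 = true → e ∈ edges (g p.1 p.2) →
      0 < qEx κ1 κ2 κ3 κ4 e.1 e.2 →
      qEx κ1 κ2 κ3 κ4 e.1 e.2 * piEx κ1 κ2 κ3 κ4 e.1 = κ3 * piEx κ1 κ2 κ3 κ4 (m, 0) →
      piEx κ1 κ2 κ3 κ4 p.1 * piEx κ1 κ2 κ3 κ4 p.2 =
        piEx κ1 κ2 κ3 κ4 (m, 0) * piEx κ1 κ2 κ3 κ4 (0, 0) →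
      m ≤ (g p.1 p.2).length →
      ENNReal.ofReal ((m : ℝ) * (piEx κ1 κ2 κ3 κ4 (0, 0) / κ3)) ≤
      (⨆ (e : (ℕ × ℕ) × (ℕ × ℕ)) (_ : 0 < qEx κ1 κ2 κ3 κ4 e.1 e.2),
      (∑' p : (ℕ × ℕ) × (ℕ × ℕ),
          if p.1 ≠ p.2 ∧ chosen p.1 p.2 = true ∧ e ∈ edges (g p.1 p.2) then
            ENNReal.ofReal (((g p.1 p.2).length : ℝ) *
              (piEx κ1 κ2 κ3 κ4 p.1 * piEx κ1 κ2 κ3 κ4 p.2))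
          else 0)
        / ENNReal.ofReal (qEx κ1 κ2 κ3 κ4 e.1 e.2 * piEx κ1 κ2 κ3 κ4 e.1)) := by
    intro e p m hne hch he hq hden hnum hm
    refine le_trans ?_ (le_iSup₂_of_le e hq le_rfl)
    refine le_trans ?_ (ENNReal.div_le_div_right (ENNReal.le_tsum p) _)
    rw [if_pos ⟨hne, hch, he⟩, hden, hnum, ← ENNReal.ofReal_div_of_pos (mul_pos h3 (pos _))]
    apply ENNReal.ofReal_le_ofReal
    have hpm := pos (m, 0)
    have e1 : ((g p.1 p.2).length : ℝ) *
        (piEx κ1 κ2 κ3 κ4 (m, 0) * piEx κ1 κ2 κ3 κ4 (0, 0)) / (κ3 * piEx κ1 κ2 κ3 κ4 (m, 0))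
        = ((g p.1 p.2).length : ℝ) * (piEx κ1 κ2 κ3 κ4 (0, 0) / κ3) := by
      field_simp
    rw [e1]
    exact mul_le_mul_of_nonneg_right (by exact_mod_cast hm) hc.le
  refine ENNReal.eq_top_of_forall_nnreal_le fun r => ?_
  obtain ⟨n, hn⟩ := exists_nat_gt ((r : ℝ) / (piEx κ1 κ2 κ3 κ4 (0, 0) / κ3))
  have hr : (r : ℝ≥0∞) ≤
      ENNReal.ofReal (((n + 1 : ℕ) : ℝ) * (piEx κ1 κ2 κ3 κ4 (0, 0) / κ3)) := by
    rw [← ENNReal.ofReal_coe_nnreal]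
    apply ENNReal.ofReal_le_ofReal
    rw [div_lt_iff₀ hc] at hn
    push_cast
    nlinarith
  refine hr.trans ?_
  have hne : ((n + 1, 0) : ℕ × ℕ) ≠ (0, 0) := by simp
  rcases hchosen _ _ hne with ⟨hch, -⟩ | ⟨hch, -⟩
  · obtain ⟨⟨-, ha, hb⟩, hact⟩ := hg _ _ hne hch
    obtain ⟨y, hy⟩ := aux_first hne ha hb
    have hq := hact _ hy
    obtain rfl := aux_q_out hq
    have hl := aux_len _ _ _ ha hb hact
    refine key ((n + 1, 0), (n + 1, 1)) ((n + 1, 0), (0, 0)) (n + 1) hne hch hy hq ?_ rfl ?_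
    · simp only [aux_q_up]
    · simpa using hl.1
  · obtain ⟨⟨-, ha, hb⟩, hact⟩ := hg _ _ hne.symm hch
    obtain ⟨y, hy⟩ := aux_last hne.symm ha hb
    have hq := hact _ hy
    obtain rfl := aux_q_in hq
    have hl := aux_len _ _ _ ha hb hact
    refine key ((n + 1, 1), (n + 1, 0)) ((0, 0), (n + 1, 0)) (n + 1) hne.symm hch hy hq ?_
      (mul_comm _ _) ?_
    · simp only [aux_q_down]
      exact aux_balance h4 _
    · simpa using hl.2
end

section
/- Example 2.13 (a detailed-balanced reaction network whose spectral gap is zero). Consider the Markov chain on ℤ²_{≥0} with rates q(x, x+e₁+e₂) = 1, q(x, x−e₁−e₂) = x₁x₂, q(x, x+e₂) = x₂, q(x, x−e₂) = x₂(x₂−1) (all other transitions rate 0), and let π(x) = e^{−2}/(x₁! x₂!). Then the spectral gap is zero: for every ε > 0 there exists a finitely supported function f : ℤ²_{≥0} → ℝ with π(f) = 0, π(f²) = 1, and (1/2) Σ_{x,z∈ℤ²_{≥0}} q(x,z)(f(z)−f(x))² π(x) < ε. -/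
open scoped ENNReal

/-- Transition rates of Example 2.13:
`q(x, x+e₁+e₂) = 1`, `q(x, x−e₁−e₂) = x₁x₂`, `q(x, x+e₂) = x₂`, `q(x, x−e₂) = x₂(x₂−1)`. -/
noncomputable def qEx13 (x z : ℕ × ℕ) : ℝ :=
  if z = (x.1 + 1, x.2 + 1) then 1
  else if x = (z.1 + 1, z.2 + 1) then (x.1 : ℝ) * x.2
  else if z = (x.1, x.2 + 1) then (x.2 : ℝ)
  else if x = (z.1, z.2 + 1) then (x.2 : ℝ) * ((x.2 : ℝ) - 1)
  else 0

/-- Stationary distribution of Example 2.13: a product of two Poisson(1). -/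
noncomputable def piEx13 (x : ℕ × ℕ) : ℝ :=
  Real.exp (-2) / ((x.1.factorial : ℝ) * (x.2.factorial : ℝ))

/-- Test function: value `α` on `{(n,0),(n+1,1)}`, value `-β` on `{(n+2,0),(n+3,1)}`. -/
noncomputable def testF (n : ℕ) (α β : ℝ) (x : ℕ × ℕ) : ℝ :=
  if x.2 ≤ 1 ∧ x.1 = x.2 + n then α
  else if x.2 ≤ 1 ∧ x.1 = x.2 + n + 2 then -β else 0

lemma testF_zero (n : ℕ) (α β : ℝ) (x : ℕ × ℕ)
    (hx : x ∉ ({(n,0),(n+1,1),(n+2,0),(n+3,1)} : Finset (ℕ × ℕ))) : testF n α β x = 0 := by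
  obtain ⟨a, b⟩ := x
  simp only [Finset.mem_insert, Finset.mem_singleton, Prod.mk.injEq, not_or] at hx
  unfold testF
  rw [if_neg (by simp only; omega), if_neg (by simp only; omega)]

lemma sum_four (n : ℕ) (g : ℕ × ℕ → ℝ) :
    ∑ x ∈ ({(n,0),(n+1,1),(n+2,0),(n+3,1)} : Finset (ℕ × ℕ)), g x
      = g (n,0) + g (n+1,1) + g (n+2,0) + g (n+3,1) := by
  rw [Finset.sum_insert (by simp), Finset.sum_insert (by simp), Finset.sum_insert (by simp),
    Finset.sum_singleton]
  ring

/-- The pairs which contribute to the Dirichlet form. -/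
def prs (n : ℕ) : Finset ((ℕ × ℕ) × (ℕ × ℕ)) :=
  {((n+1,1),(n+2,2)), ((n+1,1),(n+1,2)), ((n+2,2),(n+1,1)), ((n+1,2),(n+1,1)),
   ((n+3,1),(n+4,2)), ((n+3,1),(n+3,2)), ((n+4,2),(n+3,1)), ((n+3,2),(n+3,1))}

lemma term_up (n : ℕ) (α β : ℝ) (a b : ℕ) (h : ¬ (b = 1 ∧ (a = n+1 ∨ a = n+3))) :
    testF n α β (a, b) = testF n α β (a+1, b+1) := by
  unfold testF
  simp only
  split_ifs <;> first | rfl | (exfalso; omega)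

lemma term_vert (n : ℕ) (α β : ℝ) (a b : ℕ) (h : ¬ (b = 1 ∧ (a = n+1 ∨ a = n+3))) (hb : b ≠ 0) :
    testF n α β (a, b) = testF n α β (a, b+1) := by
  unfold testF
  simp only
  split_ifs <;> first | rfl | (exfalso; omega)

lemma term_zero (n : ℕ) (α β : ℝ) (p : (ℕ × ℕ) × (ℕ × ℕ)) (hp : p ∉ prs n) :
    (testF n α β p.1 - testF n α β p.2) ^ 2 * piEx13 p.1 * qEx13 p.1 p.2 = 0 := by
  obtain ⟨⟨a, b⟩, ⟨c, d⟩⟩ := p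
  simp only [prs, Finset.mem_insert, Finset.mem_singleton, Prod.mk.injEq, not_or] at hp
  unfold qEx13
  simp only [Prod.mk.injEq]
  split_ifs with h1 h2 h3 h4
  · obtain ⟨rfl, rfl⟩ := h1
    rw [term_up n α β a b (by rintro ⟨rfl, rfl | rfl⟩ <;> simp at hp)]; simp
  · obtain ⟨rfl, rfl⟩ := h2
    rw [term_up n α β c d (by rintro ⟨rfl, rfl | rfl⟩ <;> simp at hp)]; simp
  · obtain ⟨rfl, rfl⟩ := h3
    by_cases hb : b = 0
    · subst hb; simp
    rw [term_vert n α β c b (by rintro ⟨rfl, rfl | rfl⟩ <;> simp at hp) hb]; simp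
  · obtain ⟨rfl, rfl⟩ := h4
    by_cases hb : d = 0
    · subst hb; simp
    rw [term_vert n α β a d (by rintro ⟨rfl, rfl | rfl⟩ <;> simp at hp) hb]; simp
  · simp

lemma term_nonneg (n : ℕ) (α β : ℝ) (p : (ℕ × ℕ) × (ℕ × ℕ)) :
    0 ≤ (testF n α β p.1 - testF n α β p.2) ^ 2 * piEx13 p.1 * qEx13 p.1 p.2 := by
  have h1 : 0 ≤ piEx13 p.1 := by unfold piEx13; positivity
  have h2 : 0 ≤ qEx13 p.1 p.2 := by
    unfold qEx13
    split_ifs with h1 h2 h3 h4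
    · positivity
    · positivity
    · positivity
    · rw [h4]; push_cast; simp; positivity
    · positivity
  positivity

lemma energy (n : ℕ) (α β : ℝ) : Estar piEx13 qEx13 (testF n α β) =
    ENNReal.ofReal (2 * α ^ 2 * (Real.exp (-2) / (n+1).factorial)
      + 2 * β ^ 2 * (Real.exp (-2) / (n+3).factorial)) := by
  unfold Estar
  rw [tsum_eq_sum (s := prs n) (fun p hp => by rw [term_zero n α β p hp]; simp),
    ← ENNReal.ofReal_sum_of_nonneg (fun p _ => term_nonneg n α β p),
    show (2 : ℝ≥0∞) = ENNReal.ofReal 2 by simp,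
    ← ENNReal.ofReal_div_of_pos (by norm_num)]
  congr 1
  unfold prs
  rw [Finset.sum_insert (by simp), Finset.sum_insert (by simp), Finset.sum_insert (by simp),
    Finset.sum_insert (by simp), Finset.sum_insert (by simp), Finset.sum_insert (by simp),
    Finset.sum_insert (by simp), Finset.sum_singleton]
  have e1 : testF n α β (n+1,1) = α := by unfold testF; simp; omega
  have e2 : testF n α β (n+3,1) = -β := by
    unfold testF; rw [if_neg (by simp only; omega), if_pos (by simp only; omega)]
  have e3 : ∀ a, testF n α β (a,2) = 0 := by intro a; unfold testF; simp
  simp only [e1, e2, e3]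
  have f2 : ((n+2).factorial : ℝ) = (n+2) * (n+1).factorial := by
    rw [Nat.factorial_succ]; push_cast; ring
  have f4 : ((n+4).factorial : ℝ) = (n+4) * (n+3).factorial := by
    rw [Nat.factorial_succ]; push_cast; ring
  have g1 : ((n+1).factorial : ℝ) ≠ 0 := by positivity
  have g3 : ((n+3).factorial : ℝ) ≠ 0 := by positivity
  simp [qEx13, piEx13, f2, f4]
  field_simp
  ring

/-- Example 2.13: a detailed-balanced reaction network whose spectral gap is zero. -/
theorem example_2_13_zero_gap :
    ∀ ε : ℝ, 0 < ε → ∃ f : ℕ × ℕ → ℝ,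
      (Function.support f).Finite ∧
      (∑' x, f x * piEx13 x) = 0 ∧
      (∑' x, f x ^ 2 * piEx13 x) = 1 ∧
      Estar piEx13 qEx13 f < ENNReal.ofReal ε := by
  intro ε hε
  obtain ⟨n, hn⟩ := exists_nat_gt (2 / ε)
  have ppos : ∀ x, 0 < piEx13 x := by intro x; unfold piEx13; positivity
  obtain ⟨P, hP⟩ : ∃ P, P = piEx13 (n,0) + piEx13 (n+1,1) := ⟨_, rfl⟩
  obtain ⟨Q, hQ⟩ : ∃ Q, Q = piEx13 (n+2,0) + piEx13 (n+3,1) := ⟨_, rfl⟩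
  have hP0 : 0 < P := by rw [hP]; exact add_pos (ppos _) (ppos _)
  have hQ0 : 0 < Q := by rw [hQ]; exact add_pos (ppos _) (ppos _)
  obtain ⟨s, hs⟩ : ∃ s : ℝ, s ^ 2 * (P * Q * (P + Q)) = 1 := by
    refine ⟨1 / Real.sqrt (P * Q * (P + Q)), ?_⟩
    rw [div_pow, Real.sq_sqrt (by positivity)]
    field_simp
  have e0 : testF n (s*Q) (s*P) (n,0) = s*Q := by unfold testF; simp
  have e1 : testF n (s*Q) (s*P) (n+1,1) = s*Q := by unfold testF; simp; omega
  have e2 : testF n (s*Q) (s*P) (n+2,0) = -(s*P) := by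
    unfold testF; rw [if_neg (by simp only; omega), if_pos (by simp only; omega)]
  have e3 : testF n (s*Q) (s*P) (n+3,1) = -(s*P) := by
    unfold testF; rw [if_neg (by simp only; omega), if_pos (by simp only; omega)]
  refine ⟨testF n (s * Q) (s * P), ?_, ?_, ?_, ?_⟩
  · refine Set.Finite.subset
      ({(n,0),(n+1,1),(n+2,0),(n+3,1)} : Finset (ℕ × ℕ)).finite_toSet ?_
    intro x hx
    by_contra h
    exact hx (testF_zero n _ _ x h)
  · rw [tsum_eq_sum (fun x hx => by rw [testF_zero n _ _ x hx]; simp), sum_four, e0, e1, e2, e3]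
    linear_combination (-s * Q) * hP + s * P * hQ
  · rw [tsum_eq_sum (fun x hx => by rw [testF_zero n _ _ x hx]; simp), sum_four, e0, e1, e2, e3]
    linear_combination hs - (s * Q)^2 * hP - (s * P)^2 * hQ
  · rw [energy, ENNReal.ofReal_lt_ofReal_iff hε]
    have f1 : ((n+1).factorial : ℝ) = (n+1) * n.factorial := by
      rw [Nat.factorial_succ]; push_cast; ring
    have f3 : ((n+3).factorial : ℝ) = (n+3) * (n+2).factorial := by
      rw [Nat.factorial_succ]; push_cast; ring
    have g1 : (n.factorial : ℝ) ≠ 0 := by positivity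
    have g3 : ((n+2).factorial : ℝ) ≠ 0 := by positivity
    have k1 : Real.exp (-2) / (n+1).factorial = P / (n+2) := by
      rw [hP]; simp only [piEx13, f1, Nat.factorial_zero, Nat.factorial_one]
      field_simp; push_cast; ring
    have k3 : Real.exp (-2) / (n+3).factorial = Q / (n+4) := by
      rw [hQ]; simp only [piEx13, f3, Nat.factorial_zero, Nat.factorial_one]
      field_simp; push_cast; ring
    rw [k1, k3]
    have l : Q / ((n:ℝ)+4) ≤ Q / (n+2) := by gcongr; norm_num
    calc 2 * (s*Q)^2 * (P / (n+2)) + 2 * (s*P)^2 * (Q / (n+4))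
        ≤ 2 * (s*Q)^2 * (P / (n+2)) + 2 * (s*P)^2 * (Q / (n+2)) := by gcongr
      _ = 2 * (s ^ 2 * (P * Q * (P + Q))) / (n+2) := by ring
      _ = 2 / (n+2) := by rw [hs]; ring
      _ < ε := by
        rw [div_lt_iff₀ hε] at hn
        rw [div_lt_iff₀ (by positivity)]
        nlinarith
end
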